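/- arXiv:2009.07244 — 3 statements merged into one kernel-verified Lean document; each statement's English description precedes it below -/
import Mathlib

section
/- Let E be the extension operator of the surface {(ξ₁, ξ₂, ξ₃, ξ₁ξ₂ + ξ₃², ξ₁²) : ξ ∈ [0,1]³} ⊂ ℝ⁵. Then for every p > 4 there is a constant C_p such that for every R ≥ 1, every interval I ⊂ [0,1] of length R^{−1/2}, every ball B_R ⊂ ℝ⁵ of radius R, and every f, ‖E(f·1_{I×[0,1]²})‖_{L^p(B_R)} ≤ C_p R^{2/p − 1/2} ‖f‖_{L^p([0,1]³)}. -/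
open MeasureTheory

noncomputable section

/-- The unit cube `[0,1]³`. -/
def cube3 : Set (Fin 3 → ℝ) := Set.Icc (fun _ => 0) (fun _ => 1)

/-- The extension operator of the surface
`{(ξ₁, ξ₂, ξ₃, ξ₁ξ₂ + ξ₃², ξ₁²) : ξ ∈ [0,1]³} ⊂ ℝ⁵`. -/
def eD (f : (Fin 3 → ℝ) → ℂ) (x : EuclideanSpace ℝ (Fin 5)) : ℂ :=
  ∫ ξ in cube3, f ξ * Complex.exp (2 * (Real.pi : ℂ) * Complex.I *
    ((ξ 0 * x 0 + ξ 1 * x 1 + ξ 2 * x 2 + (ξ 0 * ξ 1 + ξ 2 ^ 2) * x 3 + ξ 0 ^ 2 * x 4 : ℝ) : ℂ))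


section planch
open FourierTransform SchwartzMap
open scoped ContDiff

lemma bi_plancherel {V : Type*} [NormedAddCommGroup V] [InnerProductSpace ℝ V]
    [FiniteDimensional ℝ V] [MeasurableSpace V] [BorelSpace V]
    (G : V → ℂ) (h1 : Integrable G) (h2 : MemLp G 2) :
    eLpNorm (𝓕 G) 2 volume = eLpNorm G 2 volume := by
  set g : Lp ℂ 2 (volume : Measure V) := h2.toLp G with hg
  have hcont : Continuous (𝓕 G) := 
    VectorFourier.fourierIntegral_continuous Real.continuous_fourierChar (by exact continuous_inner) h1
  have key : ∀ᵐ x ∂(volume : Measure V), 𝓕 G x = (𝓕 g : Lp ℂ 2 (volume : Measure V)) x := by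
    apply ae_eq_of_integral_contDiff_smul_eq
    · exact hcont.locallyIntegrable
    · exact (Lp.memLp (𝓕 g : Lp ℂ 2 (volume : Measure V))).locallyIntegrable (by norm_num)
    · intro φ hφ hc
      have hc' : HasCompactSupport (fun x => (φ x : ℂ)) := hc.comp_left (g := fun t : ℝ => (t:ℂ)) (by simp)
      set Φ : 𝓢(V, ℂ) := hc'.toSchwartzMap (Complex.ofRealCLM.contDiff.comp hφ) with hΦ
      have hΦx : ∀ x, Φ x = (φ x : ℂ) := fun x => rfl
      have e1 := congrArg (fun T => T Φ) (Lp.fourier_toTemperedDistribution_eq g)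
      simp only [TemperedDistribution.fourier_apply, Lp.toTemperedDistribution_apply] at e1
      have e2 := VectorFourier.integral_fourierIntegral_smul_eq_flip (L := innerₗ V) (μ := (volume : Measure V))
        (ν := (volume : Measure V)) (f := Φ) (g := G) Real.continuous_fourierChar (by exact continuous_inner) Φ.integrable h1
      have e3 : ∫ x, (𝓕 Φ) x • g x = ∫ x, (𝓕 Φ) x • G x := by
        apply integral_congr_ae
        filter_upwards [h2.coeFn_toLp] with x hx
        rw [hx]
      have e4 : ∫ x, φ x • (𝓕 g : Lp ℂ 2 (volume : Measure V)) x = ∫ x, Φ x • (𝓕 g : Lp ℂ 2 (volume : Measure V)) x := by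
        simp [hΦx]
      have e5 : ∫ x, φ x • 𝓕 G x = ∫ x, Φ x • 𝓕 G x := by
        simp [hΦx]
      rw [e4, e5, ← e1, e3]
      rw [flip_innerₗ] at e2
      rw [SchwartzMap.fourier_coe]
      exact e2.symm
  rw [eLpNorm_congr_ae key, ← eLpNorm_congr_ae h2.coeFn_toLp]
  have := Lp.norm_fourier_eq g
  rw [Lp.norm_def, Lp.norm_def, ENNReal.toReal_eq_toReal_iff' (Lp.eLpNorm_ne_top _) (Lp.eLpNorm_ne_top _)] at this
  exact this

end planch

lemma bi_lint_rpow (s T : ℝ) (hs : -1 < s) (hT : 0 ≤ T) :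
    ∫⁻ t in Set.Ioc 0 T, ENNReal.ofReal (t ^ s) = ENNReal.ofReal (T ^ (s+1) / (s+1)) := by
  rw [← ofReal_integral_eq_lintegral_ofReal]
  · rw [← intervalIntegral.integral_of_le hT, integral_rpow (Or.inl hs)]
    rw [Real.zero_rpow (by linarith)]
    simp
  · exact (intervalIntegrable_iff_integrableOn_Ioc_of_le hT).1
      (intervalIntegral.intervalIntegrable_rpow' hs)
  · filter_upwards [self_mem_ae_restrict measurableSet_Ioc] with t ht
    exact Real.rpow_nonneg ht.1.le _

section HY
open FourierTransform
variable {V : Type*} [NormedAddCommGroup V] [InnerProductSpace ℝ V]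
    [FiniteDimensional ℝ V] [MeasurableSpace V] [BorelSpace V]

lemma bi_level (G : V → ℂ) (hG : Measurable G) (h1 : Integrable G) (r a t : ℝ)
    (hr : 1 < r) (ha : 0 < a) (hA : ∫⁻ x, ‖G x‖ₑ ^ r = ENNReal.ofReal a) (ht : 0 < t) :
    volume {x : V | t < ‖𝓕 G x‖} ≤ ENNReal.ofReal (4 / t ^ 2) *
      ∫⁻ x, Set.indicator {x | t * ‖G x‖ ^ (r-1) ≤ 2 * a} (fun x => ‖G x‖ₑ ^ 2) x := by
  set B : Set V := {x | t * ‖G x‖ ^ (r-1) ≤ 2 * a} with hB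
  have hBm : MeasurableSet B := measurableSet_le (by fun_prop) (by fun_prop)
  set G2 := B.indicator G with hG2
  set G1 := Bᶜ.indicator G with hG1
  have i2 : Integrable G2 := h1.indicator hBm
  have i1 : Integrable G1 := h1.indicator hBm.compl
  have hsq : ∀ x, B.indicator (fun x => ‖G x‖ₑ ^ 2) x = ‖G2 x‖ₑ ^ 2 := by
    intro x
    by_cases hx : x ∈ B <;> simp [hG2, hx]
  simp_rw [hsq]
  by_cases htop : ∫⁻ x, ‖G2 x‖ₑ ^ 2 = ⊤
  · rw [htop, ENNReal.mul_top]
    · exact le_top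
    · simp; positivity
  have hn2 : eLpNorm G2 2 volume ^ 2 = ∫⁻ x, ‖G2 x‖ₑ ^ 2 := by
    simpa using eLpNorm_nnreal_pow_eq_lintegral (f := G2) (p := 2) (μ := volume) (by norm_num)
  have hm2 : MemLp G2 2 := by
    refine ⟨i2.1, ?_⟩
    rw [lt_top_iff_ne_top]
    intro h
    rw [h] at hn2
    exact htop (by rw [← hn2]; simp)
  have hP := bi_plancherel G2 i2 hm2
  have hF2 : eLpNorm (𝓕 G2) 2 volume ^ 2 = ∫⁻ x, ‖𝓕 G2 x‖ₑ ^ 2 := by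
    simpa using eLpNorm_nnreal_pow_eq_lintegral (f := 𝓕 G2) (p := 2) (μ := volume) (by norm_num)
  have hcont : Continuous (𝓕 G2) := 
    VectorFourier.fourierIntegral_continuous Real.continuous_fourierChar (by exact continuous_inner) i2
  have hsum : ∀ x, 𝓕 G x = 𝓕 G1 x + 𝓕 G2 x := by
    intro x
    have : G = G1 + G2 := by
      rw [hG1, hG2, Set.indicator_compl_add_self]
    have h := VectorFourier.fourierIntegral_add (L := innerₗ V) (μ := (volume : Measure V)) Real.continuous_fourierChar (by exact continuous_inner) i1 i2
    rw [← this] at h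
    exact congrFun h x
  have hG1b : ∫ x, ‖G1 x‖ ≤ t / 2 := by
    rw [integral_norm_eq_lintegral_enorm i1.1]
    apply ENNReal.toReal_le_of_le_ofReal (by positivity)
    calc ∫⁻ x, ‖G1 x‖ₑ ≤ ∫⁻ x, ENNReal.ofReal (t / (2*a)) * ‖G x‖ₑ ^ r := by
          apply lintegral_mono
          intro x
          by_cases hx : x ∈ B
          · simp [hG1, hx]
          · have : ‖G1 x‖ₑ = ‖G x‖ₑ := by simp [hG1, hx]
            simp only [this]
            have hx' : 2 * a < t * ‖G x‖ ^ (r-1) := by simpa [hB] using hx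
            rw [← ofReal_norm, ENNReal.ofReal_rpow_of_nonneg (norm_nonneg _) (by linarith),
              ← ENNReal.ofReal_mul (by positivity)]
            apply ENNReal.ofReal_le_ofReal
            rw [div_mul_eq_mul_div, le_div_iff₀ (by positivity)]
            have : ‖G x‖ ^ r = ‖G x‖ ^ (r-1) * ‖G x‖ := by
              rcases eq_or_ne (‖G x‖) 0 with h0 | h0
              · rw [h0, Real.zero_rpow (by linarith)]; simp
              · rw [← Real.rpow_add_one h0]; congr 1; ring
            rw [this]
            nlinarith [norm_nonneg (G x)]
      _ = ENNReal.ofReal (t/2) := by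
          rw [lintegral_const_mul _ (by fun_prop), hA, ← ENNReal.ofReal_mul (by positivity)]
          congr 1; field_simp
  have hF1 : ∀ x, ‖𝓕 G1 x‖ ≤ t / 2 := fun x =>
    (VectorFourier.norm_fourierIntegral_le_integral_norm _ _ _ _ _).trans hG1b
  have hsub : {x : V | t < ‖𝓕 G x‖} ⊆ {x | ENNReal.ofReal (t^2/4) ≤ ‖𝓕 G2 x‖ₑ ^ 2} := by
    intro x hx
    simp only [Set.mem_ofPred_eq] at hx ⊢
    rw [← ofReal_norm, ← ENNReal.ofReal_pow (norm_nonneg _)]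
    apply ENNReal.ofReal_le_ofReal
    have h3 := hF1 x
    have h4 : ‖𝓕 G x‖ ≤ ‖𝓕 G1 x‖ + ‖𝓕 G2 x‖ := by rw [hsum]; exact norm_add_le _ _
    have : t/2 ≤ ‖𝓕 G2 x‖ := by linarith
    nlinarith
  have hch := mul_meas_ge_le_lintegral₀ (μ := (volume : Measure V)) (f := fun x => ‖𝓕 G2 x‖ₑ ^ 2)
    (by fun_prop) (ENNReal.ofReal (t^2/4))
  rw [← hF2, hP, hn2] at hch
  calc _ ≤ volume {x | ENNReal.ofReal (t^2/4) ≤ ‖𝓕 G2 x‖ₑ ^ 2} := measure_mono hsub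
    _ = ENNReal.ofReal (4 / t^2) * (ENNReal.ofReal (t^2/4) * volume {x | ENNReal.ofReal (t^2/4) ≤ ‖𝓕 G2 x‖ₑ ^ 2}) := by
        rw [← mul_assoc, ← ENNReal.ofReal_mul (by positivity)]
        have : 4 / t^2 * (t^2/4) = 1 := by field_simp
        rw [this]; simp
    _ ≤ _ := by gcongr

lemma bi_HY (q : ℝ) (hq : 2 < q) : ∃ C : ENNReal, C ≠ ⊤ ∧ ∀ G : V → ℂ, Measurable G → Integrable G →
    ∫⁻ x, ‖𝓕 G x‖ₑ ^ q ≤ C * (∫⁻ x, ‖G x‖ₑ ^ (q/(q-1))) ^ (q-1) := by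
  set r := q/(q-1) with hr
  have hr1 : r - 1 = 1/(q-1) := by rw [hr]; field_simp [(by linarith : q - 1 ≠ 0)]; ring
  have hr0 : 0 < r - 1 := by rw [hr1]; apply div_pos one_pos; linarith
  refine ⟨ENNReal.ofReal (q * (4 / (q-2) * 2^(q-2))), by simp, fun G hG h1 => ?_⟩
  have hCpos : 0 < q * (4 / (q-2) * 2^(q-2)) := by
    have : 0 < q - 2 := by linarith
    positivity
  set A := ∫⁻ x, ‖G x‖ₑ ^ r with hA
  by_cases hAt : A = ⊤
  · rw [hAt, ENNReal.top_rpow_of_pos (by linarith), ENNReal.mul_top]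
    · exact le_top
    · simpa using hCpos
  by_cases hA0 : A = 0
  · have : (fun x => ‖G x‖ₑ ^ r) =ᵐ[volume] 0 := (lintegral_eq_zero_iff (by fun_prop)).1 hA0
    have hz : G =ᵐ[volume] 0 := by
      filter_upwards [this] with x hx
      simpa [ENNReal.rpow_eq_zero_iff, (by linarith : 0 < r), (by linarith : ¬ r < 0)] using hx
    have hF : ∀ x, 𝓕 G x = 0 := by
      intro x
      rw [Real.fourier_eq]
      rw [integral_eq_zero_of_ae]
      filter_upwards [hz] with y hy
      simp [hy]
    simp [hF, (by linarith : 0 < q)]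
  set a := A.toReal with ha
  have hapos : 0 < a := ENNReal.toReal_pos hA0 hAt
  have hAa : A = ENNReal.ofReal a := (ENNReal.ofReal_toReal hAt).symm
  have hcont : Continuous (𝓕 G) := 
    VectorFourier.fourierIntegral_continuous Real.continuous_fourierChar (by exact continuous_inner) h1
  have e1 : ∫⁻ x, ‖𝓕 G x‖ₑ ^ q = ∫⁻ x, ENNReal.ofReal (‖𝓕 G x‖ ^ q) := by
    congr 1; ext x
    rw [← ofReal_norm, ENNReal.ofReal_rpow_of_nonneg (norm_nonneg _) (by linarith)]
  rw [e1, lintegral_rpow_eq_lintegral_meas_lt_mul volume (Filter.Eventually.of_forall fun x => norm_nonneg _)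
    hcont.norm.aemeasurable (by linarith), ENNReal.ofReal_mul (by linarith), mul_assoc]
  gcongr
  have hpt : ∀ x, ∫⁻ t in Set.Ioi (0:ℝ), (if t * ‖G x‖ ^ (r-1) ≤ 2 * a then ‖G x‖ₑ ^ 2 else 0) * ENNReal.ofReal (4 * t ^ (q-3))
      ≤ ENNReal.ofReal (4/(q-2) * (2*a)^(q-2)) * ‖G x‖ₑ ^ r := by
    intro x
    rcases eq_or_ne (‖G x‖) 0 with h0 | h0
    · have : ‖G x‖ₑ = 0 := by simpa using h0
      simp [this]
    have hm : 0 < ‖G x‖ := lt_of_le_of_ne (norm_nonneg _) h0.symm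
    set T := 2 * a / ‖G x‖ ^ (r-1) with hT
    have hTpos : 0 < T := by positivity
    have e2 : ∀ t ∈ Set.Ioi (0:ℝ), (if t * ‖G x‖ ^ (r-1) ≤ 2 * a then ‖G x‖ₑ ^ 2 else 0) * ENNReal.ofReal (4 * t ^ (q-3))
       = (Set.Ioc 0 T).indicator (fun t => (‖G x‖ₑ ^ 2 * ENNReal.ofReal 4) * ENNReal.ofReal (t ^ (q-3))) t := by
      intro t ht
      have ht' : 0 < t := ht
      have : t * ‖G x‖ ^ (r-1) ≤ 2 * a ↔ t ∈ Set.Ioc 0 T := by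
        rw [Set.mem_Ioc, hT, le_div_iff₀ (by positivity)]; simp [ht']
      by_cases hc : t ∈ Set.Ioc 0 T
      · rw [if_pos (this.2 hc), Set.indicator_of_mem hc, ENNReal.ofReal_mul (by norm_num), mul_assoc]
      · rw [if_neg (fun h => hc (this.1 h)), Set.indicator_of_notMem hc, zero_mul]
    rw [setLIntegral_congr_fun measurableSet_Ioi e2]
    refine (setLIntegral_le_lintegral _ _).trans ?_
    rw [lintegral_indicator measurableSet_Ioc, lintegral_const_mul _ (by fun_prop),
      bi_lint_rpow _ _ (by linarith) hTpos.le]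
    rw [← ofReal_norm, ENNReal.ofReal_rpow_of_nonneg (norm_nonneg _) (by linarith),
      ← ENNReal.ofReal_pow (norm_nonneg _), ← ENNReal.ofReal_mul (by positivity), ← ENNReal.ofReal_mul (by positivity),
      ← ENNReal.ofReal_mul (by have : 0 < q - 2 := by linarith
                               positivity)]
    apply ENNReal.ofReal_le_ofReal
    apply le_of_eq
    rw [hT, (by ring : q - 3 + 1 = q - 2), Real.div_rpow (by positivity) (by positivity), ← Real.rpow_mul hm.le]
    have : ‖G x‖ ^ 2 = ‖G x‖ ^ r * ‖G x‖ ^ ((r-1)*(q-2)) := by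
      rw [← Real.rpow_add hm, ← Real.rpow_natCast]
      congr 1
      have : (r-1)*(q-1) = 1 := by rw [hr1]; field_simp [(by linarith : q - 1 ≠ 0)]
      push_cast; linarith
    rw [this]
    have : ‖G x‖ ^ ((r-1)*(q-2)) ≠ 0 := by positivity
    field_simp
  calc ∫⁻ t in Set.Ioi (0:ℝ), volume {x | t < ‖𝓕 G x‖} * ENNReal.ofReal (t ^ (q-1))
      ≤ ∫⁻ t in Set.Ioi (0:ℝ), ∫⁻ x, (if t * ‖G x‖ ^ (r-1) ≤ 2 * a then ‖G x‖ₑ ^ 2 else 0) * ENNReal.ofReal (4 * t ^ (q-3)) := by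
        apply setLIntegral_mono' measurableSet_Ioi
        intro t ht
        have ht' : 0 < t := ht
        rw [lintegral_mul_const']
        swap
        · exact ENNReal.ofReal_ne_top
        refine (mul_le_mul_left (bi_level G hG h1 r a t (by linarith) hapos (by rw [← hAa]) ht') _).trans ?_
        rw [mul_comm (ENNReal.ofReal (4/t^2)), mul_assoc, ← ENNReal.ofReal_mul (by positivity)]
        apply le_of_eq
        congr 2
        have : t ^ (q-1) = t ^ (q-3) * t ^ 2 := by
          rw [← Real.rpow_natCast, ← Real.rpow_add ht']; congr 1; push_cast; ring
        rw [this]; field_simp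
    _ = ∫⁻ x, ∫⁻ t in Set.Ioi (0:ℝ), (if t * ‖G x‖ ^ (r-1) ≤ 2 * a then ‖G x‖ₑ ^ 2 else 0) * ENNReal.ofReal (4 * t ^ (q-3)) := by
        apply lintegral_lintegral_swap
        apply Measurable.aemeasurable
        apply Measurable.mul
        · apply Measurable.ite
          · apply measurableSet_le <;> fun_prop
          · fun_prop
          · fun_prop
        · fun_prop
    _ ≤ ∫⁻ x, ENNReal.ofReal (4/(q-2) * (2*a)^(q-2)) * ‖G x‖ₑ ^ r := lintegral_mono hpt
    _ = ENNReal.ofReal (4/(q-2) * (2*a)^(q-2)) * A := by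
        rw [lintegral_const_mul _ (by fun_prop)]
    _ ≤ _ := by
        have : 0 < q - 2 := by linarith
        rw [hAa, ENNReal.ofReal_rpow_of_pos hapos, ← ENNReal.ofReal_mul (by positivity), ← ENNReal.ofReal_mul (by positivity)]
        apply le_of_eq
        congr 1
        rw [Real.mul_rpow (by norm_num) hapos.le, (by ring : q - 1 = q - 2 + 1), Real.rpow_add_one hapos.ne']
        ring
end HY

def bie (θ : ℝ) : ℂ := Complex.exp (2 * (Real.pi : ℂ) * Complex.I * (θ : ℂ))

lemma bie_norm (θ : ℝ) : ‖bie θ‖ = 1 := by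
  have : bie θ = Complex.exp (((2 * Real.pi * θ : ℝ) : ℂ) * Complex.I) := by
    unfold bie; congr 1; push_cast; ring
  rw [this, Complex.norm_exp_ofReal_mul_I]

lemma bie_enorm (θ : ℝ) : ‖bie θ‖ₑ = 1 := by
  rw [← ofReal_norm, bie_norm]; simp

lemma bie_add (θ φ : ℝ) : bie (θ + φ) = bie θ * bie φ := by
  unfold bie; rw [← Complex.exp_add]; congr 1; push_cast; ring

lemma bie_cont : Continuous bie := by unfold bie; fun_prop

@[fun_prop]
lemma bie_meas : Measurable bie := bie_cont.measurable

lemma bi_integrable_mul {α : Type*} [MeasurableSpace α] {μ : Measure α} (G : α → ℂ) (hG : Measurable G)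
    (φ : α → ℝ) (hφ : Measurable φ) : Integrable (fun u => G u * bie (φ u)) μ ↔ Integrable G μ := by
  apply integrable_congr'
  · exact (hG.mul (bie_meas.comp hφ)).aestronglyMeasurable
  · exact hG.aestronglyMeasurable
  · filter_upwards with x
    simp [bie_norm]

open FourierTransform in
lemma bi_HY2 (q : ℝ) (hq : 2 < q) : ∃ C : ENNReal, C ≠ ⊤ ∧ ∀ G : ℝ × ℝ → ℂ, Measurable G →
    ∫⁻ x : ℝ × ℝ, ‖∫ u : ℝ × ℝ, G u * bie (u.1 * x.1 + u.2 * x.2)‖ₑ ^ q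
      ≤ C * (∫⁻ x, ‖G x‖ₑ ^ (q/(q-1))) ^ (q-1) := by
  obtain ⟨C, hC, h⟩ := bi_HY (V := EuclideanSpace ℝ (Fin 2)) q hq
  refine ⟨C, hC, fun G hG => ?_⟩
  by_cases hi : Integrable G
  swap
  · have : ∀ x : ℝ × ℝ, ∫ u : ℝ × ℝ, G u * bie (u.1 * x.1 + u.2 * x.2) = 0 := by
      intro x
      apply integral_undef
      rw [bi_integrable_mul G hG _ (by fun_prop)]
      exact hi
    simp [this, (by linarith : 0 < q)]
  let m : EuclideanSpace ℝ (Fin 2) ≃ᵐ ℝ × ℝ :=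
    (MeasurableEquiv.toLp 2 (Fin 2 → ℝ)).symm.trans MeasurableEquiv.finTwoArrow
  have hm : MeasurePreserving m := 
    (volume_preserving_finTwoArrow ℝ).comp (EuclideanSpace.volume_preserving_symm_measurableEquiv_toLp (Fin 2))
  have hm0 : ∀ v, m v = (v 0, v 1) := fun v => rfl
  have h1 := h (G ∘ m) (hG.comp m.measurable) (hm.integrable_comp_of_integrable hi)
  have e1 : ∫⁻ x, ‖(G ∘ m) x‖ₑ ^ (q/(q-1)) = ∫⁻ x, ‖G x‖ₑ ^ (q/(q-1)) :=
    hm.lintegral_comp (f := fun x => ‖G x‖ₑ ^ (q/(q-1))) (by fun_prop)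
  rw [e1] at h1
  refine le_trans (le_of_eq ?_) h1
  rw [← hm.lintegral_comp_emb m.measurableEmbedding]
  rw [← lintegral_neg_eq_self]
  congr 1
  ext x
  congr 2
  rw [Real.fourier_eq, ← hm.integral_comp m.measurableEmbedding]
  congr 1
  ext v
  rw [hm0, hm0]
  simp only [Real.fourierChar, PiLp.inner_apply, Function.comp, hm0]
  rw [Circle.smul_def, smul_eq_mul, mul_comm]
  congr 1
  simp [bie, Circle.coe_exp, Fin.sum_univ_two]
  congr 1
  ring

lemma bi_jensen {α : Type*} [MeasurableSpace α] {μ : Measure α} (S : Set α) (hS : MeasurableSet S)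
    (h : α → ℂ) (hm : Measurable h) (hz : ∀ x, x ∉ S → h x = 0) (a b : ℝ) (ha : 0 < a) (hab : a ≤ b) :
    (∫⁻ x, ‖h x‖ₑ ^ a ∂μ) ^ (b/a) ≤ μ S ^ (b/a - 1) * ∫⁻ x, ‖h x‖ₑ ^ b ∂μ := by
  have key := eLpNorm'_le_eLpNorm'_mul_rpow_measure_univ (μ := μ.restrict S) ha hab hm.aestronglyMeasurable
  have hb : 0 < b := by linarith
  have e : ∀ c : ℝ, 0 < c → ∫⁻ x in S, ‖h x‖ₑ ^ c ∂μ = ∫⁻ x, ‖h x‖ₑ ^ c ∂μ := by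
    intro c hc
    rw [← lintegral_indicator hS]
    congr 1
    ext x
    by_cases hx : x ∈ S
    · simp [hx]
    · simp [hx, hz x hx, hc]
  rw [eLpNorm'_eq_lintegral_enorm, eLpNorm'_eq_lintegral_enorm, e a ha, e b hb] at key
  have k2 := ENNReal.rpow_le_rpow key hb.le
  rw [ENNReal.mul_rpow_of_nonneg _ _ hb.le, ← ENNReal.rpow_mul, ← ENNReal.rpow_mul, ← ENNReal.rpow_mul] at k2
  rw [mul_comm]
  convert! k2 using 2
  · field_simp
  · field_simp; simp
  · rw [Measure.restrict_apply_univ]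
    congr 1; field_simp

def biΦ (z : ℝ × ℝ) : ℝ × ℝ := (z.1 + z.2, z.1 ^ 2 + z.2 ^ 2)
def biw (u : ℝ × ℝ) : ℝ := √(2 * u.2 - u.1 ^ 2)
def biD : Set (ℝ × ℝ) := {z | z.1 < z.2}
def bidΦ (z : ℝ × ℝ) : ℝ × ℝ →L[ℝ] ℝ × ℝ :=
  (Matrix.toLin (.finTwoProd ℝ) (.finTwoProd ℝ) !![1, 1; 2 * z.1, 2 * z.2]).toContinuousLinearMap

lemma biD_meas : MeasurableSet biD := measurableSet_lt measurable_fst measurable_snd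

lemma biw_Φ (z : ℝ × ℝ) (hz : z ∈ biD) : biw (biΦ z) = z.2 - z.1 := by
  have hz' : z.1 < z.2 := hz
  unfold biw biΦ
  rw [show 2 * (z.1 ^ 2 + z.2 ^ 2) - (z.1 + z.2) ^ 2 = (z.2 - z.1) ^ 2 by ring]
  exact Real.sqrt_sq (by linarith)

lemma biΦ_1 (z : ℝ × ℝ) (hz : z ∈ biD) : ((biΦ z).1 - biw (biΦ z)) / 2 = z.1 := by
  rw [biw_Φ z hz]; unfold biΦ; ring
lemma biΦ_2 (z : ℝ × ℝ) (hz : z ∈ biD) : ((biΦ z).1 + biw (biΦ z)) / 2 = z.2 := by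
  rw [biw_Φ z hz]; unfold biΦ; ring

lemma biΦ_inj : Set.InjOn biΦ biD := by
  intro z hz z' hz' h
  ext
  · rw [← biΦ_1 z hz, ← biΦ_1 z' hz', h]
  · rw [← biΦ_2 z hz, ← biΦ_2 z' hz', h]

lemma biΦ_deriv (z : ℝ × ℝ) : HasFDerivAt biΦ (bidΦ z) z := by
  unfold bidΦ
  rw [Matrix.toLin_finTwoProd_toContinuousLinearMap]
  have h1 : HasFDerivAt (fun z : ℝ × ℝ => z.1) (ContinuousLinearMap.fst ℝ ℝ ℝ) z := hasFDerivAt_fst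
  have h2 : HasFDerivAt (fun z : ℝ × ℝ => z.2) (ContinuousLinearMap.snd ℝ ℝ ℝ) z := hasFDerivAt_snd
  convert! HasFDerivAt.prodMk (𝕜 := ℝ) (h1.add h2) ((h1.pow 2).add (h2.pow 2)) using 2 <;> simp

lemma bidΦ_det (z : ℝ × ℝ) : (bidΦ z).det = 2 * (z.2 - z.1) := by
  unfold bidΦ
  rw [LinearMap.det_toContinuousLinearMap, LinearMap.det_toLin, Matrix.det_fin_two_of]; ring

def biG (g : ℝ → ℂ) : ℝ × ℝ → ℂ := (biΦ '' biD).indicator fun u =>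
  (g ((u.1 - biw u) / 2) * g ((u.1 + biw u) / 2)) * ((2 * biw u : ℝ) : ℂ)⁻¹

lemma biw_meas : Measurable biw := by unfold biw; fun_prop
lemma biΦ_cont : Continuous biΦ := by unfold biΦ; fun_prop
lemma biIm_meas : MeasurableSet (biΦ '' biD) :=
  biD_meas.image_of_continuousOn_injOn biΦ_cont.continuousOn biΦ_inj

lemma biG_meas (g : ℝ → ℂ) (hg : Measurable g) : Measurable (biG g) := by
  apply Measurable.indicator _ biIm_meas
  have := biw_meas
  fun_prop

lemma biG_Φ (g : ℝ → ℂ) (z : ℝ × ℝ) (hz : z ∈ biD) :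
    biG g (biΦ z) = g z.1 * g z.2 * ((2 * (z.2 - z.1) : ℝ) : ℂ)⁻¹ := by
  unfold biG
  rw [Set.indicator_of_mem (Set.mem_image_of_mem _ hz), biΦ_1 z hz, biΦ_2 z hz, biw_Φ z hz]

lemma biG_int (g : ℝ → ℂ) (x : ℝ × ℝ) :
    ∫ u : ℝ × ℝ, biG g u * bie (u.1 * x.1 + u.2 * x.2) =
    ∫ z in biD, g z.1 * g z.2 * bie ((z.1 + z.2) * x.1 + (z.1 ^ 2 + z.2 ^ 2) * x.2) := by
  have h := integral_image_eq_integral_abs_det_fderiv_smul (volume : Measure (ℝ × ℝ)) biD_meas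
    (fun z _ => (biΦ_deriv z).hasFDerivWithinAt) biΦ_inj (fun u => biG g u * bie (u.1 * x.1 + u.2 * x.2))
  rw [setIntegral_eq_integral_of_forall_compl_eq_zero] at h
  · rw [h]
    apply setIntegral_congr_fun biD_meas
    intro z hz
    have hz' : z.1 < z.2 := hz
    simp only
    rw [biG_Φ g z hz, bidΦ_det, abs_of_pos (by linarith), Complex.real_smul]
    have : ((2 * (z.2 - z.1) : ℝ) : ℂ) ≠ 0 := by
      rw [Complex.ofReal_ne_zero]; linarith
    unfold biΦ
    field_simp
  · intro u hu
    unfold biG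
    rw [Set.indicator_of_notMem hu, zero_mul]

lemma bi_diag : biDᶜ =ᵐ[(volume : Measure (ℝ × ℝ))] Prod.swap ⁻¹' biD := by
  have h0 : (volume : Measure (ℝ × ℝ)) {z | z.1 = z.2} = 0 := by
    rw [Measure.volume_eq_prod, Measure.measure_prod_null (measurableSet_eq_fun measurable_fst measurable_snd)]
    filter_upwards with x
    have : Prod.mk x ⁻¹' {z : ℝ × ℝ | z.1 = z.2} = {x} := by ext y; simp [eq_comm]
    rw [this]; simp
  have h1 : ∀ᵐ z : ℝ × ℝ, ¬ (z.1 = z.2) := by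
    rw [ae_iff]; simpa using h0
  filter_upwards [h1] with z hz
  apply propext
  change ¬ (z.1 < z.2) ↔ z.2 < z.1
  rw [not_lt]
  exact ⟨fun h => lt_of_le_of_ne h (Ne.symm hz), le_of_lt⟩

lemma bi_sq (g : ℝ → ℂ) (hg : Measurable g) (hi : Integrable g) (x : ℝ × ℝ) :
    (∫ ξ, g ξ * bie (ξ * x.1 + ξ ^ 2 * x.2)) ^ 2 =
      2 * ∫ u : ℝ × ℝ, biG g u * bie (u.1 * x.1 + u.2 * x.2) := by
  rw [biG_int]
  set H : ℝ × ℝ → ℂ := fun z => g z.1 * g z.2 * bie ((z.1 + z.2) * x.1 + (z.1 ^ 2 + z.2 ^ 2) * x.2) with hH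
  have hH2 : ∀ z : ℝ × ℝ, H z = (g z.1 * bie (z.1 * x.1 + z.1 ^ 2 * x.2)) * (g z.2 * bie (z.2 * x.1 + z.2 ^ 2 * x.2)) := by
    intro z
    simp only [hH]
    rw [show (z.1 + z.2) * x.1 + (z.1 ^ 2 + z.2 ^ 2) * x.2 = (z.1 * x.1 + z.1 ^ 2 * x.2) + (z.2 * x.1 + z.2 ^ 2 * x.2) by ring, bie_add]
    ring
  have hii : Integrable (fun ξ => g ξ * bie (ξ * x.1 + ξ ^ 2 * x.2)) :=
    (bi_integrable_mul g hg _ (by fun_prop)).2 hi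
  have hHi : Integrable H := by
    have := hii.mul_prod hii
    refine this.congr (Filter.Eventually.of_forall fun z => (hH2 z).symm)
  have e1 : (∫ ξ, g ξ * bie (ξ * x.1 + ξ ^ 2 * x.2)) ^ 2 = ∫ z, H z := by
    simp_rw [hH2]
    rw [sq, Measure.volume_eq_prod]
    exact (integral_prod_mul (fun ξ => g ξ * bie (ξ * x.1 + ξ ^ 2 * x.2)) (fun ξ => g ξ * bie (ξ * x.1 + ξ ^ 2 * x.2))).symm
  have e2 : ∫ z in biDᶜ, H z = ∫ z in biD, H z := by
    have hs := setIntegral_congr_set (f := H) bi_diag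
    refine Eq.trans hs ?_
    have hsw : MeasurePreserving (Prod.swap : ℝ × ℝ → ℝ × ℝ) := Measure.measurePreserving_swap
    rw [← hsw.setIntegral_preimage_emb MeasurableEquiv.prodComm.measurableEmbedding]
    congr 1
    ext z
    simp only [hH, Prod.fst_swap, Prod.snd_swap]
    rw [add_comm z.2 z.1, add_comm (z.2^2), mul_comm (g z.2)]
  rw [e1, ← integral_add_compl biD_meas hHi, e2]; ring

lemma bi_ab (a b : ENNReal) (r : ℝ) (hr : 0 ≤ r) : (a * b) ^ r ≤ a ^ (2 * r) + b ^ (2 * r) := by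
  have e : ∀ c : ENNReal, c ^ (2 * r) = (c * c) ^ r := by
    intro c
    rw [ENNReal.rpow_mul]; congr 1; simp [sq]
  rw [e, e]
  rcases le_total a b with h | h
  · exact (ENNReal.rpow_le_rpow (mul_le_mul_left h b) hr).trans le_add_self
  · exact (ENNReal.rpow_le_rpow (mul_le_mul_right h a) hr).trans le_self_add

lemma biG_norm (g : ℝ → ℂ) (hg : Measurable g) (h0 : ∀ x, x ∉ Set.Icc (0:ℝ) 1 → g x = 0)
    (r : ℝ) (hr1 : 1 < r) (hr2 : r < 2) :
    ∫⁻ u, ‖biG g u‖ₑ ^ r ≤ ENNReal.ofReal (2 / (2 - r)) * ∫⁻ ξ, ‖g ξ‖ₑ ^ (2 * r) := by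
  set k : ℝ → ENNReal := (Set.Ioc (0:ℝ) 1).indicator fun w => ENNReal.ofReal (w ^ (1 - r)) with hk
  have hkm : Measurable k := Measurable.indicator (by fun_prop) measurableSet_Ioc
  have hkint : ∫⁻ w, k w = ENNReal.ofReal (1 / (2 - r)) := by
    rw [hk, lintegral_indicator measurableSet_Ioc, bi_lint_rpow _ _ (by linarith) (by norm_num)]
    congr 1
    rw [Real.one_rpow]; congr 1; ring
  have h := lintegral_image_eq_lintegral_abs_det_fderiv_mul (volume : Measure (ℝ × ℝ)) biD_meas
    (fun z _ => (biΦ_deriv z).hasFDerivWithinAt) biΦ_inj (fun u => ‖biG g u‖ₑ ^ r)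
  have e1 : ∫⁻ u, ‖biG g u‖ₑ ^ r = ∫⁻ u in biΦ '' biD, ‖biG g u‖ₑ ^ r := by
    rw [← lintegral_indicator biIm_meas]
    congr 1; ext u
    by_cases hu : u ∈ biΦ '' biD
    · rw [Set.indicator_of_mem hu]
    · rw [Set.indicator_of_notMem hu, biG, Set.indicator_of_notMem hu]
      simp; linarith
  have hpt : ∀ z ∈ biD, ENNReal.ofReal |(bidΦ z).det| * ‖biG g (biΦ z)‖ₑ ^ r ≤
      (‖g z.1‖ₑ ^ (2*r) + ‖g z.2‖ₑ ^ (2*r)) * k (z.2 - z.1) := by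
    intro z hz
    have hz' : z.1 < z.2 := hz
    rw [biG_Φ g z hz, bidΦ_det, abs_of_pos (by linarith)]
    by_cases hz1 : z.1 ∈ Set.Icc (0:ℝ) 1
    swap
    · simp [h0 _ hz1, (by linarith : 0 < r)]
    by_cases hz2 : z.2 ∈ Set.Icc (0:ℝ) 1
    swap
    · simp [h0 _ hz2, (by linarith : 0 < r)]
    have hw : z.2 - z.1 ∈ Set.Ioc (0:ℝ) 1 := ⟨by linarith, by linarith [hz1.1, hz2.2]⟩
    have hwpos : 0 < z.2 - z.1 := hw.1
    rw [hk, Set.indicator_of_mem hw, enorm_mul, ENNReal.mul_rpow_of_nonneg _ _ (by linarith), enorm_mul]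
    rw [mul_comm, mul_assoc]
    apply mul_le_mul' (bi_ab _ _ r (by linarith))
    rw [← ofReal_norm (_ : ℂ), norm_inv, Complex.norm_real, Real.norm_of_nonneg (by linarith),
      ENNReal.ofReal_rpow_of_nonneg (by positivity) (by linarith), ← ENNReal.ofReal_mul (by positivity)]
    apply ENNReal.ofReal_le_ofReal
    have : (2 * (z.2 - z.1))⁻¹ ^ r * (2 * (z.2 - z.1)) = (2 * (z.2 - z.1)) ^ (1 - r) := by
      rw [Real.rpow_sub (by positivity), Real.rpow_one, Real.inv_rpow (by positivity)]
      field_simp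
    rw [this]
    exact Real.rpow_le_rpow_of_nonpos hwpos (by linarith) (by linarith)
  rw [e1, h]
  calc _ ≤ ∫⁻ z in biD, (‖g z.1‖ₑ ^ (2*r) + ‖g z.2‖ₑ ^ (2*r)) * k (z.2 - z.1) := setLIntegral_mono' biD_meas hpt
    _ ≤ ∫⁻ z : ℝ × ℝ, (‖g z.1‖ₑ ^ (2*r) + ‖g z.2‖ₑ ^ (2*r)) * k (z.2 - z.1) := setLIntegral_le_lintegral _ _
    _ = (∫⁻ z : ℝ × ℝ, ‖g z.1‖ₑ ^ (2*r) * k (z.2 - z.1)) + ∫⁻ z : ℝ × ℝ, ‖g z.2‖ₑ ^ (2*r) * k (z.2 - z.1) := by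
        rw [← lintegral_add_left (by fun_prop)]
        simp_rw [add_mul]
    _ = ENNReal.ofReal (1/(2-r)) * (∫⁻ ξ, ‖g ξ‖ₑ ^ (2 * r)) + ENNReal.ofReal (1/(2-r)) * (∫⁻ ξ, ‖g ξ‖ₑ ^ (2 * r)) := by
        congr 1
        · rw [Measure.volume_eq_prod, lintegral_prod _ (by fun_prop), ← lintegral_const_mul _ (by fun_prop)]
          congr 1; ext ξ
          simp only
          rw [lintegral_const_mul _ (by fun_prop), lintegral_sub_right_eq_self, hkint, mul_comm]
        · rw [Measure.volume_eq_prod, lintegral_prod_symm _ (by fun_prop), ← lintegral_const_mul _ (by fun_prop)]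
          congr 1; ext ξ
          simp only
          rw [lintegral_const_mul _ (by fun_prop), lintegral_sub_left_eq_self, hkint, mul_comm]
    _ = _ := by
        rw [← add_mul, ← ENNReal.ofReal_add (by apply div_nonneg <;> linarith) (by apply div_nonneg <;> linarith)]
        congr 2; ring

lemma bi_parab (p : ℝ) (hp : 4 < p) : ∃ C : ENNReal, C ≠ ⊤ ∧ ∀ g : ℝ → ℂ, Measurable g →
    (∀ x, x ∉ Set.Icc (0:ℝ) 1 → g x = 0) →
    ∫⁻ x : ℝ × ℝ, ‖∫ ξ, g ξ * bie (ξ * x.1 + ξ ^ 2 * x.2)‖ₑ ^ p ≤ C * ∫⁻ ξ, ‖g ξ‖ₑ ^ p := by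
  obtain ⟨q, rfl⟩ : ∃ q, p = 2 * q := ⟨p/2, by ring⟩
  have hq : 2 < q := by linarith
  have hq1 : 0 < q - 1 := by linarith
  obtain ⟨C, hC, h⟩ := bi_HY2 q hq
  set r := q/(q-1) with hr
  have hr1 : 1 < r := by rw [hr, lt_div_iff₀ hq1]; linarith
  have hr2 : r < 2 := by rw [hr, div_lt_iff₀ hq1]; linarith
  refine ⟨2 ^ q * (C * (ENNReal.ofReal (2 / (2 - r))) ^ (q-1)), ?_, fun g hg h0 => ?_⟩
  · apply ENNReal.mul_ne_top
    · exact ENNReal.rpow_ne_top_of_nonneg (by linarith) (by simp)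
    · exact ENNReal.mul_ne_top hC (ENNReal.rpow_ne_top_of_nonneg (by linarith) (by simp))
  by_cases hi : Integrable g
  swap
  · have : ∀ x : ℝ × ℝ, ∫ ξ, g ξ * bie (ξ * x.1 + ξ ^ 2 * x.2) = 0 := by
      intro x
      apply integral_undef
      rw [bi_integrable_mul g hg _ (by fun_prop)]
      exact hi
    simp [this, (by linarith : 0 < q)]
  have e1 : ∀ x : ℝ × ℝ, ‖∫ ξ, g ξ * bie (ξ * x.1 + ξ ^ 2 * x.2)‖ₑ ^ (2 * q) =
      2 ^ q * ‖∫ u : ℝ × ℝ, biG g u * bie (u.1 * x.1 + u.2 * x.2)‖ₑ ^ q := by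
    intro x
    rw [ENNReal.rpow_mul, ← ENNReal.mul_rpow_of_nonneg _ _ (by linarith)]
    congr 1
    have := congrArg (fun z : ℂ => ‖z‖ₑ) (bi_sq g hg hi x)
    simp only [enorm_pow, enorm_mul] at this
    rw [show (2:ℝ) = ((2:ℕ):ℝ) by norm_num, ENNReal.rpow_natCast, this]
    congr 1
    rw [← ofReal_norm]; simp
  simp_rw [e1]
  rw [lintegral_const_mul' _ _ (ENNReal.rpow_ne_top_of_nonneg (by linarith) (by simp)), mul_assoc]
  gcongr
  refine (h (biG g) (biG_meas g hg)).trans ?_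
  rw [mul_assoc]
  gcongr
  refine (ENNReal.rpow_le_rpow (biG_norm g hg h0 r hr1 hr2) hq1.le).trans ?_
  rw [ENNReal.mul_rpow_of_nonneg _ _ hq1.le]
  gcongr
  have hj := bi_jensen (μ := volume) (Set.Icc (0:ℝ) 1) measurableSet_Icc g hg h0 (2*r) (2*q) (by linarith) (by linarith)
  have e2 : 2 * q / (2 * r) = q - 1 := by rw [hr]; field_simp
  rw [e2] at hj
  simpa using hj

def biθ (y : ((ℝ × ℝ) × (ℝ × ℝ)) × ℝ) (ξ : (ℝ × ℝ) × ℝ) : ℝ :=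
  ξ.1.1 * y.1.1.1 + ξ.1.2 * y.1.1.2 + ξ.2 * y.1.2.1 + (ξ.1.1 * ξ.1.2 + ξ.2 ^ 2) * y.1.2.2 + ξ.1.1 ^ 2 * y.2

def biT (F : (ℝ × ℝ) × ℝ → ℂ) (y : ((ℝ × ℝ) × (ℝ × ℝ)) × ℝ) : ℂ :=
  ∫ ξ : (ℝ × ℝ) × ℝ, F ξ * bie (biθ y ξ)

lemma biT_meas (F : (ℝ × ℝ) × ℝ → ℂ) (hF : Measurable F) : Measurable (biT F) := by
  have : StronglyMeasurable (fun z : (((ℝ × ℝ) × (ℝ × ℝ)) × ℝ) × ((ℝ × ℝ) × ℝ) => F z.2 * bie (biθ z.1 z.2)) := by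
    apply Measurable.stronglyMeasurable
    unfold biθ
    fun_prop
  exact (this.integral_prod_right' (ν := volume)).measurable

lemma bi_core (p : ℝ) (hp : 4 < p) : ∃ C : ENNReal, C ≠ ⊤ ∧ ∀ (F : (ℝ × ℝ) × ℝ → ℂ), Measurable F →
    ∀ S : Set (ℝ × ℝ), MeasurableSet S → (∀ ξ, ξ ∉ S ×ˢ Set.Icc (0:ℝ) 1 → F ξ = 0) → ∀ t : ℝ,
    ∫⁻ w : (ℝ × ℝ) × (ℝ × ℝ), ‖biT F (w, t)‖ₑ ^ p ≤ C * (volume S ^ (p - 2) * ∫⁻ ξ, ‖F ξ‖ₑ ^ p) := by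
  obtain ⟨C1, hC1, h1⟩ := bi_HY2 p (by linarith)
  obtain ⟨C2, hC2, h2⟩ := bi_parab p hp
  refine ⟨C1 * C2, ENNReal.mul_ne_top hC1 hC2, fun F hF S hS h0 t => ?_⟩
  by_cases hi : Integrable F
  swap
  · have : ∀ y, biT F y = 0 := by
      intro y
      apply integral_undef
      rw [bi_integrable_mul F hF _ (by unfold biθ; fun_prop)]
      exact hi
    simp [this, (by linarith : 0 < p)]
  set h : (ℝ × ℝ) → (ℝ × ℝ) → ℂ := fun v η => ∫ s, F (η, s) * bie (s * v.1 + s ^ 2 * v.2) with hh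
  have hhm : Measurable (fun z : (ℝ × ℝ) × (ℝ × ℝ) => h z.1 z.2) := by
    have : StronglyMeasurable (fun z : ((ℝ × ℝ) × (ℝ × ℝ)) × ℝ => F (z.1.2, z.2) * bie (z.2 * z.1.1.1 + z.2 ^ 2 * z.1.1.2)) := by
      apply Measurable.stronglyMeasurable
      fun_prop
    exact (this.integral_prod_right' (ν := volume)).measurable
  have hhm1 : ∀ v, Measurable (h v) := fun v => hhm.comp (measurable_const.prodMk measurable_id)
  have hT : ∀ z v : ℝ × ℝ, biT F ((z, v), t) =
      ∫ η : ℝ × ℝ, (h v η * bie (η.1 * η.2 * v.2 + η.1 ^ 2 * t)) * bie (η.1 * z.1 + η.2 * z.2) := by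
    intro z v
    unfold biT
    rw [Measure.volume_eq_prod, integral_prod]
    · congr 1; ext η
      rw [mul_assoc, hh, ← integral_mul_const]
      congr 1; ext s
      rw [mul_assoc, ← bie_add, ← bie_add]
      congr 2
      unfold biθ; ring
    · rw [← Measure.volume_eq_prod]
      exact (bi_integrable_mul F hF _ (by unfold biθ; fun_prop)).2 hi
  have hv : ∀ v : ℝ × ℝ, ∫⁻ z : ℝ × ℝ, ‖biT F ((z, v), t)‖ₑ ^ p ≤
      C1 * (volume S ^ (p-2) * ∫⁻ η, ‖h v η‖ₑ ^ p) := by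
    intro v
    simp_rw [hT]
    refine (h1 (fun η => h v η * bie (η.1 * η.2 * v.2 + η.1 ^ 2 * t)) (by have := hhm1 v; fun_prop)).trans ?_
    gcongr
    simp_rw [enorm_mul, bie_enorm, mul_one]
    have hj := bi_jensen (μ := volume) S hS (h v) (hhm1 v) (fun η hη => by
      have : ∀ s, F (η, s) = 0 := fun s => h0 _ (fun hc => hη hc.1)
      simp [hh, this]) (p/(p-1)) p (by apply div_pos <;> linarith)
      (by rw [div_le_iff₀ (by linarith)]; nlinarith)
    have e : p / (p/(p-1)) = p - 1 := by field_simp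
    rw [e, show p - 1 - 1 = p - 2 by ring] at hj
    exact hj
  have hTm : Measurable (fun w : (ℝ × ℝ) × (ℝ × ℝ) => ‖biT F (w, t)‖ₑ ^ p) := by
    have := biT_meas F hF
    fun_prop
  have hsw : AEMeasurable (fun w : (ℝ × ℝ) × (ℝ × ℝ) => ‖biT F (w, t)‖ₑ ^ p) ((volume : Measure (ℝ × ℝ)).prod volume) := hTm.aemeasurable
  calc ∫⁻ w : (ℝ × ℝ) × (ℝ × ℝ), ‖biT F (w, t)‖ₑ ^ p = ∫⁻ v : ℝ × ℝ, ∫⁻ z : ℝ × ℝ, ‖biT F ((z, v), t)‖ₑ ^ p := by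
        rw [Measure.volume_eq_prod, lintegral_prod_symm _ hsw]
    _ ≤ ∫⁻ v : ℝ × ℝ, C1 * (volume S ^ (p-2) * ∫⁻ η, ‖h v η‖ₑ ^ p) := lintegral_mono hv
    _ = C1 * (volume S ^ (p-2) * ∫⁻ v : ℝ × ℝ, ∫⁻ η, ‖h v η‖ₑ ^ p) := by
        have hm2 : Measurable fun v : ℝ × ℝ => ∫⁻ η, ‖h v η‖ₑ ^ p :=
          Measurable.lintegral_prod_right' (f := fun z : (ℝ × ℝ) × (ℝ × ℝ) => ‖h z.1 z.2‖ₑ ^ p) (by fun_prop)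
        rw [lintegral_const_mul _ (by fun_prop), lintegral_const_mul _ hm2]
    _ = C1 * (volume S ^ (p-2) * ∫⁻ η : ℝ × ℝ, ∫⁻ v : ℝ × ℝ, ‖h v η‖ₑ ^ p) := by
        rw [lintegral_lintegral_swap]
        exact Measurable.aemeasurable (f := fun z : (ℝ × ℝ) × (ℝ × ℝ) => ‖h z.1 z.2‖ₑ ^ p) (by fun_prop)
    _ ≤ C1 * (volume S ^ (p-2) * ∫⁻ η : ℝ × ℝ, C2 * ∫⁻ s, ‖F (η, s)‖ₑ ^ p) := by
        gcongr with η
        exact h2 (fun s => F (η, s)) (by fun_prop) (fun s hs => h0 _ (fun hc => hs hc.2))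
    _ = _ := by
        rw [lintegral_const_mul' _ _ hC2, Measure.volume_eq_prod (ℝ × ℝ) ℝ, lintegral_prod _ (by fun_prop)]
        ring

def bim3 (ξ : (ℝ × ℝ) × ℝ) : Fin 3 → ℝ := ![ξ.1.1, ξ.1.2, ξ.2]
def bim5 (y : ((ℝ × ℝ) × (ℝ × ℝ)) × ℝ) : Fin 5 → ℝ := ![y.1.1.1, y.1.1.2, y.1.2.1, y.1.2.2, y.2]

lemma bim3_meas : Measurable bim3 := by
  apply measurable_pi_lambda
  intro i
  fin_cases i <;> simp [bim3] <;> fun_prop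

lemma bim5_meas : Measurable bim5 := by
  apply measurable_pi_lambda
  intro i
  fin_cases i <;> simp [bim5] <;> fun_prop

lemma bim3_mp : MeasurePreserving bim3 := by
  refine ⟨bim3_meas, ?_⟩
  symm
  apply Measure.pi_eq
  intro s hs
  rw [Measure.map_apply bim3_meas (MeasurableSet.univ_pi hs)]
  have : bim3 ⁻¹' (Set.univ.pi s) = (s 0 ×ˢ s 1) ×ˢ s 2 := by
    ext ξ
    simp [bim3, Set.mem_pi, Fin.forall_fin_succ, and_assoc]
  rw [this, Fin.prod_univ_three, Measure.volume_eq_prod, Measure.prod_prod, Measure.volume_eq_prod, Measure.prod_prod]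

lemma bim5_mp : MeasurePreserving bim5 := by
  refine ⟨bim5_meas, ?_⟩
  symm
  apply Measure.pi_eq
  intro s hs
  rw [Measure.map_apply bim5_meas (MeasurableSet.univ_pi hs)]
  have : bim5 ⁻¹' (Set.univ.pi s) = ((s 0 ×ˢ s 1) ×ˢ (s 2 ×ˢ s 3)) ×ˢ s 4 := by
    ext ξ
    simp [bim5, Set.mem_pi, Fin.forall_fin_succ, and_assoc]
  rw [this, Fin.prod_univ_five]
  simp only [Measure.volume_eq_prod, Measure.prod_prod]
  ring

lemma cube3_meas : MeasurableSet cube3 := measurableSet_Icc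

lemma bi_main (p : ℝ) (hp : 4 < p) : ∃ K : ENNReal, K ≠ ⊤ ∧ ∀ (F : (Fin 3 → ℝ) → ℂ), Measurable F →
    ∀ a δ : ℝ, (∀ ξ, ξ ∉ ({ξ : Fin 3 → ℝ | ξ 0 ∈ Set.Icc a (a + δ)} ∩ cube3) → F ξ = 0) → 
    ∀ c R, ∫⁻ x in Metric.ball c R, ‖eD F x‖ₑ ^ p ≤
      ENNReal.ofReal (2 * R) * (K * (ENNReal.ofReal δ ^ (p-2) * ∫⁻ ξ, ‖F ξ‖ₑ ^ p)) := by
  obtain ⟨K, hK, h⟩ := bi_core p hp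
  refine ⟨K, hK, fun F hF a δ h0 c R => ?_⟩
  set F' : (ℝ × ℝ) × ℝ → ℂ := F ∘ bim3 with hF'
  have hF'm : Measurable F' := hF.comp bim3_meas
  set S : Set (ℝ × ℝ) := Set.Icc a (a + δ) ×ˢ Set.Icc (0:ℝ) 1 with hS
  have hSm : MeasurableSet S := measurableSet_Icc.prod measurableSet_Icc
  have hSv : volume S = ENNReal.ofReal δ := by
    rw [hS, Measure.volume_eq_prod, Measure.prod_prod]; simp
  have h0' : ∀ ξ, ξ ∉ S ×ˢ Set.Icc (0:ℝ) 1 → F' ξ = 0 := by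
    intro ξ hξ
    apply h0
    intro hc
    apply hξ
    obtain ⟨hc1, hc2⟩ := hc
    have hc3 : ∀ i, 0 ≤ bim3 ξ i := fun i => hc2.1 i
    have hc4 : ∀ i, bim3 ξ i ≤ 1 := fun i => hc2.2 i
    exact ⟨⟨hc1, hc3 1, hc4 1⟩, hc3 2, hc4 2⟩
  have hn : ∫⁻ ξ, ‖F' ξ‖ₑ ^ p = ∫⁻ ξ, ‖F ξ‖ₑ ^ p :=
    bim3_mp.lintegral_comp (f := fun ξ => ‖F ξ‖ₑ ^ p) (by fun_prop)
  have hcore := h F' hF'm S hSm h0'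
  rw [hSv, hn] at hcore
  set M : ((ℝ × ℝ) × (ℝ × ℝ)) × ℝ → EuclideanSpace ℝ (Fin 5) := fun y => WithLp.toLp 2 (bim5 y) with hM
  have hMp : MeasurePreserving M := (PiLp.volume_preserving_toLp (Fin 5)).comp bim5_mp
  have hED : ∀ y, eD F (M y) = biT F' y := by
    intro y
    unfold eD biT
    rw [setIntegral_eq_integral_of_forall_compl_eq_zero]
    · rw [← bim3_mp.map_eq, integral_map_of_stronglyMeasurable bim3_meas]
      · rfl
      · apply Measurable.stronglyMeasurable
        fun_prop
    · intro ξ hξ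
      rw [h0 ξ (fun hc => hξ hc.2), zero_mul]
  set J : Set ℝ := Metric.ball (c 4) R with hJ
  have hJm : MeasurableSet J := measurableSet_ball
  calc ∫⁻ x in Metric.ball c R, ‖eD F x‖ₑ ^ p
      = ∫⁻ x, (Metric.ball c R).indicator (fun x => ‖eD F x‖ₑ ^ p) x := by
        rw [lintegral_indicator measurableSet_ball]
    _ ≤ ∫⁻ y, (Metric.ball c R).indicator (fun x => ‖eD F x‖ₑ ^ p) (M y) := by
        rw [← hMp.map_eq]
        exact lintegral_map_le _ _
    _ ≤ ∫⁻ y, J.indicator 1 y.2 * ‖biT F' y‖ₑ ^ p := by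
        apply lintegral_mono
        intro y
        by_cases hy : M y ∈ Metric.ball c R
        · have hyJ : y.2 ∈ J := by
            rw [hJ, Metric.mem_ball]
            rw [Metric.mem_ball] at hy
            refine lt_of_le_of_lt ?_ hy
            rw [dist_eq_norm, dist_eq_norm]
            exact PiLp.norm_apply_le (M y - c) 4
          simp [hy, hyJ, hED]
        · simp [hy]
    _ = ∫⁻ t, ∫⁻ w, J.indicator 1 t * ‖biT F' (w, t)‖ₑ ^ p := by
        have := biT_meas F' hF'm
        rw [Measure.volume_eq_prod, lintegral_prod_symm]
        apply Measurable.aemeasurable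
        apply Measurable.mul
        · exact (measurable_one.indicator hJm).comp measurable_snd
        · fun_prop
    _ = ∫⁻ t, J.indicator 1 t * ∫⁻ w, ‖biT F' (w, t)‖ₑ ^ p := by
        congr 1; ext t
        rw [lintegral_const_mul']
        by_cases ht : t ∈ J <;> simp [ht]
    _ ≤ ∫⁻ t, J.indicator 1 t * (K * (ENNReal.ofReal δ ^ (p-2) * ∫⁻ ξ, ‖F ξ‖ₑ ^ p)) := by
        gcongr with t
        exact hcore t
    _ = _ := by
        rw [lintegral_mul_const _ (measurable_one.indicator hJm), lintegral_indicator hJm]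
        simp [hJ, Real.volume_ball]

lemma bi_final (p : ℝ) (hp : 4 < p) :
    ∃ C : ℝ, 0 < C ∧ ∀ R : ℝ, 1 ≤ R → ∀ a : ℝ,
      ∀ c : EuclideanSpace ℝ (Fin 5), ∀ f : (Fin 3 → ℝ) → ℂ,
        eLpNorm (eD (Set.indicator
            ({ξ : Fin 3 → ℝ | ξ 0 ∈ Set.Icc a (a + R ^ (-(1:ℝ)/2))} ∩ cube3) f))
          (ENNReal.ofReal p) (volume.restrict (Metric.ball c R)) ≤
        ENNReal.ofReal (C * R ^ (2/p - 1/2)) *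
          eLpNorm f (ENNReal.ofReal p) (volume.restrict cube3) := by
  obtain ⟨K, hK, hmain⟩ := bi_main p hp
  have hp0 : 0 < p := by linarith
  set k := K.toReal with hk
  have hk0 : 0 ≤ k := ENNReal.toReal_nonneg
  refine ⟨(2 * k + 1) ^ (1/p), by positivity, fun R hR a c f => ?_⟩
  have hR0 : 0 < R := by linarith
  set δ := R ^ (-(1:ℝ)/2) with hδ
  set S3 := ({ξ : Fin 3 → ℝ | ξ 0 ∈ Set.Icc a (a + δ)} ∩ cube3) with hS3
  have hS3m : MeasurableSet S3 := (measurableSet_Icc.preimage (measurable_pi_apply 0)).inter cube3_meas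
  set F0 := S3.indicator f with hF0
  have hpne : ENNReal.ofReal p ≠ 0 := by simpa using hp0
  have hpr : (ENNReal.ofReal p).toReal = p := ENNReal.toReal_ofReal hp0.le
  by_cases hae : AEStronglyMeasurable F0 (volume.restrict cube3)
  swap
  · have hz : eD F0 = 0 := by
      ext x
      apply integral_undef
      intro hi
      apply hae
      have hc : Continuous fun ξ : Fin 3 → ℝ => Complex.exp (-(2 * (Real.pi : ℂ) * Complex.I *
        ((ξ 0 * x 0 + ξ 1 * x 1 + ξ 2 * x 2 + (ξ 0 * ξ 1 + ξ 2 ^ 2) * x 3 + ξ 0 ^ 2 * x 4 : ℝ) : ℂ))) := by fun_prop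
      have := hi.1.mul hc.aestronglyMeasurable
      refine this.congr (Filter.Eventually.of_forall fun ξ => ?_)
      simp only [Pi.mul_apply]
      rw [mul_assoc, ← Complex.exp_add, add_neg_cancel, Complex.exp_zero, mul_one]
    rw [hz]; simp
  set F := S3.indicator (hae.mk F0) with hF
  have hFm : Measurable F := hae.stronglyMeasurable_mk.measurable.indicator hS3m
  have hFz : ∀ ξ, ξ ∉ S3 → F ξ = 0 := fun ξ hξ => Set.indicator_of_notMem hξ _
  have hFF0 : F0 =ᵐ[volume.restrict cube3] F := by
    filter_upwards [hae.ae_eq_mk] with ξ hξ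
    by_cases hm : ξ ∈ S3
    · rw [hF, Set.indicator_of_mem hm, ← hξ]
    · rw [hFz ξ hm, hF0, Set.indicator_of_notMem hm]
  have hE : eD F0 = eD F := by
    ext x
    apply integral_congr_ae
    filter_upwards [hFF0] with ξ hξ
    rw [hξ]
  have hnorm : ∫⁻ ξ, ‖F ξ‖ₑ ^ p ≤ ∫⁻ ξ in cube3, ‖f ξ‖ₑ ^ p := by
    calc ∫⁻ ξ, ‖F ξ‖ₑ ^ p = ∫⁻ ξ in cube3, ‖F ξ‖ₑ ^ p := by
          rw [← lintegral_indicator cube3_meas]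
          congr 1; ext ξ
          by_cases hm : ξ ∈ cube3
          · simp [hm]
          · simp [hm, hFz ξ (fun hc => hm hc.2), hp0]
      _ = ∫⁻ ξ in cube3, ‖F0 ξ‖ₑ ^ p := by
          apply lintegral_congr_ae
          filter_upwards [hFF0] with ξ hξ
          rw [hξ]
      _ ≤ _ := by
          apply lintegral_mono
          intro ξ
          by_cases hm : ξ ∈ S3 <;> simp [hF0, hm, hp0]
  have hb := hmain F hFm a δ hFz c R
  rw [hE, eLpNorm_eq_lintegral_rpow_enorm_toReal hpne ENNReal.ofReal_ne_top,
    eLpNorm_eq_lintegral_rpow_enorm_toReal hpne ENNReal.ofReal_ne_top, hpr]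
  set N := ∫⁻ ξ in cube3, ‖f ξ‖ₑ ^ p with hN
  have hδ0 : 0 < δ := by positivity
  have hconst : ENNReal.ofReal ((2 * k + 1) ^ (1/p) * R ^ (2/p - 1/2)) = (ENNReal.ofReal ((2*k+1) * R ^ (2 - p/2))) ^ (1/p) := by
    rw [ENNReal.ofReal_rpow_of_nonneg (by positivity) (by positivity), Real.mul_rpow (by positivity) (by positivity),
      ← Real.rpow_mul hR0.le]
    congr 3
    field_simp
  rw [hconst, ← ENNReal.mul_rpow_of_nonneg _ _ (by positivity)]
  apply ENNReal.rpow_le_rpow _ (by positivity)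
  refine hb.trans ?_
  calc ENNReal.ofReal (2 * R) * (K * (ENNReal.ofReal δ ^ (p-2) * ∫⁻ ξ, ‖F ξ‖ₑ ^ p)) 
      ≤ ENNReal.ofReal (2 * R) * (K * (ENNReal.ofReal δ ^ (p-2) * N)) := by gcongr
    _ = ENNReal.ofReal (2 * k * R ^ (2 - p/2)) * N := by
        rw [← ENNReal.ofReal_toReal hK, ← hk, ENNReal.ofReal_rpow_of_pos hδ0, ← mul_assoc, ← mul_assoc,
          ← ENNReal.ofReal_mul (by positivity), ← ENNReal.ofReal_mul (by positivity)]
        congr 2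
        have : R ^ (2 - p/2) = R * δ ^ (p-2) := by
          rw [hδ, ← Real.rpow_mul hR0.le, ← Real.rpow_one_add' hR0.le]
          · congr 1; ring
          · intro h; linarith
        rw [this]; ring
    _ ≤ _ := by
        gcongr
        linarith

theorem base_induction_first (p : ℝ) (hp : 4 < p) :
    ∃ C : ℝ, 0 < C ∧ ∀ R : ℝ, 1 ≤ R → ∀ a : ℝ,
      Set.Icc a (a + R ^ (-(1:ℝ)/2)) ⊆ Set.Icc (0:ℝ) 1 →
      ∀ c : EuclideanSpace ℝ (Fin 5), ∀ f : (Fin 3 → ℝ) → ℂ,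
        eLpNorm (eD (Set.indicator
            ({ξ : Fin 3 → ℝ | ξ 0 ∈ Set.Icc a (a + R ^ (-(1:ℝ)/2))} ∩ cube3) f))
          (ENNReal.ofReal p) (volume.restrict (Metric.ball c R)) ≤
        ENNReal.ofReal (C * R ^ (2/p - 1/2)) *
          eLpNorm f (ENNReal.ofReal p) (volume.restrict cube3) := by
  obtain ⟨C, hC, h⟩ := bi_final p hp
  exact ⟨C, hC, fun R hR a _ c f => h R hR a c f⟩
end
end

section
/- Let E be the extension operator of the surface {(ξ₁, ξ₂, ξ₃, ξ₁ξ₂ + ξ₃², ξ₁²) : ξ ∈ [0,1]³} ⊂ ℝ⁵. Then for every p > 4 there is a constant C_p such that for every R ≥ 1, every interval J ⊂ [0,1] of length R^{−1/2}, every ball B_R ⊂ ℝ⁵ of radius R, and every f, ‖E(f·1_{[0,1]²×J})‖_{L^p(B_R)} ≤ C_p R^{−1/3 + 1/p} ‖f‖_{L^p([0,1]³)}. -/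
open MeasureTheory

noncomputable section

abbrev V5 := EuclideanSpace ℝ (Fin 5)

lemma gaussFT (R : ℝ) (hR : 0 < R) (c w : V5) :
    ‖∫ x : V5, Complex.exp (2 * (Real.pi : ℂ) * Complex.I * ((inner ℝ w x : ℝ) : ℂ)) *
      ((Real.exp (-Real.pi / R^2 * ‖x - c‖^2) : ℝ) : ℂ)‖ = R^5 * Real.exp (-Real.pi * R^2 * ‖w‖^2) := by
  rw [← integral_add_right_eq_self _ c]
  have h1 : ∀ x : V5, Complex.exp (2 * (Real.pi : ℂ) * Complex.I * ((inner ℝ w (x + c) : ℝ) : ℂ)) *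
      ((Real.exp (-Real.pi / R^2 * ‖x + c - c‖^2) : ℝ) : ℂ) =
      Complex.exp (2 * (Real.pi : ℂ) * Complex.I * ((inner ℝ w c : ℝ) : ℂ)) *
      Complex.exp (-(((Real.pi / R^2 : ℝ)) : ℂ) * ‖x‖^2 + (2 * (Real.pi : ℂ) * Complex.I) * ((inner ℝ w x : ℝ) : ℂ)) := by
    intro x
    rw [inner_add_right, add_sub_cancel_right, Complex.ofReal_exp, ← Complex.exp_add, ← Complex.exp_add]
    congr 1
    push_cast
    ring
  simp_rw [h1]
  rw [integral_const_mul, GaussianFourier.integral_cexp_neg_mul_sq_norm_add, norm_mul]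
  · have : ‖Complex.exp (2 * (Real.pi : ℂ) * Complex.I * ((inner ℝ w c : ℝ) : ℂ))‖ = 1 := by
      rw [Complex.norm_exp]
      simp
    rw [this, one_mul, norm_mul, finrank_euclideanSpace_fin]
    congr 1
    · have h2 : (Real.pi : ℂ) / ((Real.pi / R^2 : ℝ) : ℂ) = ((R^2 : ℝ) : ℂ) := by
        have := Real.pi_ne_zero
        rw [← Complex.ofReal_div]
        congr 1
        field_simp
      rw [h2, Complex.norm_cpow_eq_rpow_re_of_pos (by positivity)]
      simp only [Complex.div_re]
      norm_num
      rw [← Real.rpow_natCast_mul hR.le, ← Real.rpow_natCast]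
      norm_num
    · rw [Complex.norm_exp]
      congr 1
      have : (2 * (Real.pi : ℂ) * Complex.I) ^ 2 * ‖w‖ ^ 2 / (4 * ((Real.pi / R^2 : ℝ) : ℂ)) = ((-Real.pi * R^2 * ‖w‖^2 : ℝ) : ℂ) := by
        have := Real.pi_ne_zero
        have h3 : (Real.pi : ℂ) ≠ 0 := by exact_mod_cast this
        have h4 : (R : ℂ) ≠ 0 := by exact_mod_cast hR.ne'
        push_cast
        rw [mul_pow, Complex.I_sq]
        field_simp
        ring
      rw [this, Complex.ofReal_re]
  · rw [Complex.ofReal_re]; have := Real.pi_pos; positivity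

lemma L2bound {Y : Type*} [MeasurableSpace Y] (ν : Measure Y) [SFinite ν] (h : Y → ℂ)
    (hh : Integrable h ν) (Ψ : Y → V5) (hΨ : Measurable Ψ) (c : V5) (R : ℝ) (hR : 0 < R) :
    ∫⁻ x, ‖∫ y, h y * Complex.exp (2 * (Real.pi : ℂ) * Complex.I * ((inner ℝ (Ψ y) x : ℝ) : ℂ)) ∂ν‖ₑ^2
      * ENNReal.ofReal (Real.exp (-Real.pi / R^2 * ‖x - c‖^2)) ≤
    ∫⁻ y, ∫⁻ y', ‖h y‖ₑ * ‖h y'‖ₑ *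
      ENNReal.ofReal (R^5 * Real.exp (-Real.pi * R^2 * ‖Ψ y - Ψ y'‖^2)) ∂ν ∂ν := by
  set H : V5 → ℂ := fun x => ∫ y, h y * Complex.exp (2 * (Real.pi : ℂ) * Complex.I * ((inner ℝ (Ψ y) x : ℝ) : ℂ)) ∂ν with hH
  set w : V5 → ℝ := fun x => Real.exp (-Real.pi / R^2 * ‖x - c‖^2) with hw
  set k : Y × Y → ℂ := fun z => h z.1 * (starRingEnd ℂ) (h z.2) with hk
  have hki : Integrable k (ν.prod ν) := by
    exact Integrable.mul_prod (g := fun y => (starRingEnd ℂ) (h y)) hh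
      ((LinearIsometryEquiv.integrable_comp_iff (Complex.conjLIE)).2 hh)
  have hwi : Integrable w := by
    have h0 := GaussianFourier.integrable_cexp_neg_mul_sq_norm_add (V := V5) (b := ((Real.pi / R^2 : ℝ) : ℂ))
      (by rw [Complex.ofReal_re]; have := Real.pi_pos; positivity) 0 0
    have h1 := (h0.norm).comp_sub_right c
    refine h1.congr (Filter.Eventually.of_forall fun x => ?_)
    simp only [hw, Complex.norm_exp]
    congr 1
    simp [← Complex.ofReal_pow, neg_div]
  set e : V5 × (Y × Y) → ℂ := fun q => Complex.exp (2 * (Real.pi : ℂ) * Complex.I * ((inner ℝ (Ψ q.2.1 - Ψ q.2.2) q.1 : ℝ) : ℂ)) with he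
  have hem : Measurable e := by
    simp only [he]; fun_prop
  have hen : ∀ q, ‖e q‖ = 1 := by
    intro q
    simp only [he, Complex.norm_exp]; simp
  have hJ : Integrable (fun q : V5 × (Y × Y) => (((w q.1 : ℝ) : ℂ) * k q.2) * e q) (volume.prod (ν.prod ν)) := by
    refine (Integrable.mul_prod (hwi.ofReal (𝕜 := ℂ)) hki).mul_bdd (c := 1) hem.aestronglyMeasurable ?_
    exact Filter.Eventually.of_forall fun q => (hen q).le
  have hHH : ∀ x, ∫ z, ((w x : ℂ) * k z) * e (x, z) ∂(ν.prod ν) = ((‖H x‖^2 * w x : ℝ) : ℂ) := by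
    intro x
    have : ∀ z : Y × Y, ((w x : ℂ) * k z) * e (x, z) = (w x : ℂ) *
        ((h z.1 * Complex.exp (2 * (Real.pi : ℂ) * Complex.I * ((inner ℝ (Ψ z.1) x : ℝ) : ℂ))) *
        (starRingEnd ℂ) (h z.2 * Complex.exp (2 * (Real.pi : ℂ) * Complex.I * ((inner ℝ (Ψ z.2) x : ℝ) : ℂ)))) := by
      intro z
      have h1 : e (x, z) = Complex.exp (2 * (Real.pi : ℂ) * Complex.I * ((inner ℝ (Ψ z.1) x : ℝ) : ℂ)) *
          (starRingEnd ℂ) (Complex.exp (2 * (Real.pi : ℂ) * Complex.I * ((inner ℝ (Ψ z.2) x : ℝ) : ℂ))) := by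
        rw [← Complex.exp_conj, ← Complex.exp_add]
        simp only [he, inner_sub_left]
        congr 1
        simp only [map_mul, Complex.conj_I, Complex.conj_ofReal, Complex.conj_ofNat]
        push_cast
        ring
      rw [h1, map_mul]
      simp only [hk]
      ring
    simp_rw [this]
    rw [integral_const_mul, integral_prod_mul
      (f := fun y => h y * Complex.exp (2 * (Real.pi : ℂ) * Complex.I * ((inner ℝ (Ψ y) x : ℝ) : ℂ)))
      (g := fun y => (starRingEnd ℂ) (h y * Complex.exp (2 * (Real.pi : ℂ) * Complex.I * ((inner ℝ (Ψ y) x : ℝ) : ℂ)))),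
      integral_conj, Complex.mul_conj, Complex.normSq_eq_norm_sq]
    push_cast
    rw [mul_comm]
  have hGi : Integrable (fun x => ‖H x‖^2 * w x) := by
    have := hJ.integral_prod_left
    simp only [hHH] at this
    exact this.re
  have hw0 : ∀ x, 0 ≤ w x := fun x => (Real.exp_pos _).le
  calc ∫⁻ x, ‖H x‖ₑ^2 * ENNReal.ofReal (w x) = ∫⁻ x, ENNReal.ofReal (‖H x‖^2 * w x) := by
        refine lintegral_congr fun x => ?_
        rw [ENNReal.ofReal_mul (by positivity), ENNReal.ofReal_pow (norm_nonneg _), ofReal_norm]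
    _ = ENNReal.ofReal (∫ x, ‖H x‖^2 * w x) := by
        rw [ofReal_integral_eq_lintegral_ofReal hGi]
        exact Filter.Eventually.of_forall fun x => mul_nonneg (by positivity) (hw0 x)
    _ = ‖∫ x, ((‖H x‖^2 * w x : ℝ) : ℂ)‖ₑ := by
        rw [integral_complex_ofReal, ← ofReal_norm, Complex.norm_of_nonneg]
        exact integral_nonneg fun x => mul_nonneg (by positivity) (hw0 x)
    _ = ‖∫ x, ∫ z, ((w x : ℂ) * k z) * e (x, z) ∂(ν.prod ν)‖ₑ := by simp_rw [hHH]
    _ = ‖∫ z, (∫ x, ((w x : ℂ) * k z) * e (x, z)) ∂(ν.prod ν)‖ₑ := by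
        rw [integral_integral_swap hJ]
    _ ≤ ∫⁻ z, ‖∫ x, ((w x : ℂ) * k z) * e (x, z)‖ₑ ∂(ν.prod ν) := enorm_integral_le_lintegral_enorm _
    _ = ∫⁻ z, ‖h z.1‖ₑ * ‖h z.2‖ₑ * ENNReal.ofReal (R^5 * Real.exp (-Real.pi * R^2 * ‖Ψ z.1 - Ψ z.2‖^2)) ∂(ν.prod ν) := by
        refine lintegral_congr fun z => ?_
        have : ∀ x, ((w x : ℂ) * k z) * e (x, z) = k z * (e (x,z) * (w x : ℂ)) := fun x => by ring
        simp_rw [this]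
        rw [integral_const_mul, enorm_mul]
        congr 1
        · simp only [hk]; rw [enorm_mul, ← ofReal_norm ((starRingEnd ℂ) (h z.2)), RCLike.norm_conj, ofReal_norm]
        · rw [← ofReal_norm, gaussFT R hR c (Ψ z.1 - Ψ z.2)]
    _ = _ := by
        rw [lintegral_prod]
        have := hh.aestronglyMeasurable.enorm
        exact ((this.comp_fst).mul this.comp_snd).mul (by fun_prop)

def gk (R t : ℝ) : ENNReal := ENNReal.ofReal (R * Real.exp (-Real.pi * R^2 * t^2))

lemma gk_meas (R : ℝ) : Measurable (gk R) := by unfold gk; fun_prop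

@[fun_prop]
lemma gk_meas' {α : Type*} [MeasurableSpace α] (R : ℝ) (t : α → ℝ) (ht : Measurable t) :
    Measurable (fun a => gk R (t a)) := (gk_meas R).comp ht

lemma gk_le (R t : ℝ) (hR : 0 < R) : gk R t ≤ ENNReal.ofReal R := by
  unfold gk
  apply ENNReal.ofReal_le_ofReal
  have : Real.exp (-Real.pi * R^2 * t^2) ≤ 1 := by
    rw [Real.exp_le_one_iff]
    have := Real.pi_pos
    have : 0 ≤ Real.pi * R^2 * t^2 := by positivity
    linarith
  nlinarith

lemma gauss_lint (b m : ℝ) (hb : 0 < b) :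
    ∫⁻ y : ℝ, ENNReal.ofReal (Real.exp (-b * (y - m)^2)) = ENNReal.ofReal (Real.sqrt (Real.pi / b)) := by
  rw [lintegral_sub_right_eq_self (fun y => ENNReal.ofReal (Real.exp (-b * y^2))) m]
  rw [← integral_gaussian, ofReal_integral_eq_lintegral_ofReal (integrable_exp_neg_mul_sq hb)]
  exact Filter.Eventually.of_forall fun x => (Real.exp_pos _).le

lemma gk_lint_lin (R a d : ℝ) (hR : 0 < R) (ha : a ≠ 0) :
    ∫⁻ y : ℝ, gk R (a * y + d) = ENNReal.ofReal (1 / |a|) := by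
  unfold gk
  have hpi := Real.pi_pos
  have : ∀ y : ℝ, ENNReal.ofReal (R * Real.exp (-Real.pi * R^2 * (a * y + d)^2)) =
      ENNReal.ofReal R * ENNReal.ofReal (Real.exp (-(Real.pi * R^2 * a^2) * (y - (-d/a))^2)) := by
    intro y
    rw [ENNReal.ofReal_mul hR.le]
    have : a * y + d = a * (y - (-d/a)) := by field_simp; ring
    rw [this]
    congr 3
    ring
  simp_rw [this]
  rw [lintegral_const_mul' _ _ ENNReal.ofReal_ne_top, gauss_lint _ _ (by positivity), ← ENNReal.ofReal_mul hR.le]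
  congr 1
  have : Real.pi / (Real.pi * R^2 * a^2) = (1 / (R * |a|))^2 := by
    rw [div_pow, mul_pow, sq_abs]; field_simp
  rw [this, Real.sqrt_sq (by positivity)]
  field_simp

lemma gk_lint_shift (R d : ℝ) (hR : 0 < R) : ∫⁻ y : ℝ, gk R (y + d) = 1 := by
  have := gk_lint_lin R 1 d hR one_ne_zero
  simpa using this

lemma gk_lint_neg (R d : ℝ) (hR : 0 < R) : ∫⁻ y : ℝ, gk R (d - y) = 1 := by
  have := gk_lint_lin R (-1) d hR (by norm_num)
  have h2 : ∀ y, d - y = -1 * y + d := fun y => by ring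
  simp_rw [h2, this]; simp

lemma quad_pt (R y c m : ℝ) (hR : 0 < R) (hm : m = Real.sqrt (-c)) :
    Real.exp (-Real.pi * R^2 * (2 * (y^2 + c))^2) ≤
      Real.exp Real.pi * Real.exp (-(4 * Real.pi * R) * (y - m)^2) +
      Real.exp Real.pi * Real.exp (-(4 * Real.pi * R) * (y - (-m))^2) := by
  have hpi := Real.pi_pos
  have key : ∀ s : ℝ, s^4 ≤ (y^2+c)^2 → Real.exp (-Real.pi * R^2 * (2 * (y^2 + c))^2) ≤
      Real.exp Real.pi * Real.exp (-(4 * Real.pi * R) * s^2) := by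
    intro s hs
    rw [← Real.exp_add, Real.exp_le_exp]
    have h1 : R * s^2 - 1/4 ≤ R^2 * (y^2+c)^2 := by
      have : R^2 * s^4 ≤ R^2 * (y^2+c)^2 := by gcongr
      nlinarith [sq_nonneg (R * s^2 - 1/2)]
    nlinarith
  have hm0 : 0 ≤ m := hm ▸ Real.sqrt_nonneg _
  have hc : 0 ≤ c ∧ m = 0 ∨ c = -m^2 := by
    rcases le_total 0 c with h | h
    · left; exact ⟨h, hm ▸ Real.sqrt_eq_zero_of_nonpos (by linarith)⟩
    · right; rw [hm, Real.sq_sqrt (by linarith)]; ring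
  rcases le_total 0 y with hy | hy
  · refine (key (y - m) ?_).trans (le_add_of_nonneg_right (by positivity))
    rcases hc with ⟨h, h0⟩ | h
    · subst h0; nlinarith [sq_nonneg y, mul_nonneg (sq_nonneg y) h]
    · rw [h]
      have h3 : (y-m)^2 ≤ (y+m)^2 := by nlinarith [mul_nonneg hy hm0]
      nlinarith [mul_le_mul_of_nonneg_left h3 (sq_nonneg (y-m))]
  · refine (key (y - (-m)) ?_).trans (le_add_of_nonneg_left (by positivity))
    rcases hc with ⟨h, h0⟩ | h
    · rw [h0]; nlinarith [sq_nonneg y, mul_nonneg (sq_nonneg y) h]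
    · rw [h]
      have h3 : (y+m)^2 ≤ (y-m)^2 := by nlinarith [mul_nonneg (neg_nonneg.2 hy) hm0]
      nlinarith [mul_le_mul_of_nonneg_left h3 (sq_nonneg (y+m))]

lemma gk_quad (R b c : ℝ) (hR : 0 < R) :
    ∫⁻ y : ℝ, gk R (2 * y^2 + b * y + c) ≤ ENNReal.ofReal (Real.exp Real.pi * Real.sqrt R) := by
  have hpi := Real.pi_pos
  set c' := c / 2 - (b/4)^2 with hc'
  rw [← lintegral_sub_right_eq_self _ (b/4)]
  set m := Real.sqrt (-c') with hm
  have h1 : ∀ y : ℝ, gk R (2 * (y - b/4)^2 + b * (y - b/4) + c) ≤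
      ENNReal.ofReal (R * Real.exp Real.pi) * ENNReal.ofReal (Real.exp (-(4 * Real.pi * R) * (y - m)^2)) +
      ENNReal.ofReal (R * Real.exp Real.pi) * ENNReal.ofReal (Real.exp (-(4 * Real.pi * R) * (y - (-m))^2)) := by
    intro y
    unfold gk
    rw [← ENNReal.ofReal_mul (by positivity), ← ENNReal.ofReal_mul (by positivity), ← ENNReal.ofReal_add (by positivity) (by positivity)]
    apply ENNReal.ofReal_le_ofReal
    have := quad_pt R y c' m hR hm
    have h2 : 2 * (y - b/4)^2 + b * (y - b/4) + c = 2 * (y^2 + c') := by rw [hc']; ring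
    rw [h2]
    nlinarith
  refine (lintegral_mono h1).trans ?_
  rw [lintegral_add_left (by fun_prop), lintegral_const_mul' _ _ ENNReal.ofReal_ne_top,
    lintegral_const_mul' _ _ ENNReal.ofReal_ne_top, gauss_lint _ _ (by positivity), gauss_lint _ _ (by positivity),
    ← ENNReal.ofReal_mul (by positivity), ← ENNReal.ofReal_add (by positivity) (by positivity)]
  apply ENNReal.ofReal_le_ofReal
  have h3 : Real.pi / (4 * Real.pi * R) = (1 / (2 * Real.sqrt R))^2 := by
    rw [div_pow, mul_pow, Real.sq_sqrt hR.le]; field_simp; norm_num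
  rw [h3, Real.sqrt_sq (by positivity)]
  have h4 := Real.sq_sqrt hR.le
  have h5 := Real.sqrt_pos.2 hR
  apply le_of_eq
  field_simp
  nlinarith

/-- weight min(R,1/|u|) ≤ R^{1/6}|u|^{-5/6} -/
def mw (R u : ℝ) : ENNReal := ENNReal.ofReal (R ^ (1/6 : ℝ)) * ENNReal.ofReal |u| ^ (-(5/6) : ℝ)

@[fun_prop]
lemma mw_meas (R : ℝ) : Measurable (mw R) := by unfold mw; fun_prop

lemma mw_lint (R : ℝ) (hR : 1 ≤ R) :
    ∫⁻ u in Set.Icc (-1:ℝ) 1, mw R u ≤ ENNReal.ofReal (12 * R ^ (1/6 : ℝ)) := by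
  unfold mw
  rw [lintegral_const_mul' _ _ ENNReal.ofReal_ne_top]
  have hpos : ∫⁻ u in Set.Ioc (0:ℝ) 1, ENNReal.ofReal |u| ^ (-(5/6) : ℝ) = ENNReal.ofReal 6 := by
    have h1 : ∫⁻ u in Set.Ioc (0:ℝ) 1, ENNReal.ofReal |u| ^ (-(5/6) : ℝ) =
        ∫⁻ u in Set.Ioc (0:ℝ) 1, ENNReal.ofReal (u ^ (-(5/6) : ℝ)) := by
      refine setLIntegral_congr_fun measurableSet_Ioc fun u hu => ?_
      rw [abs_of_pos hu.1, ENNReal.ofReal_rpow_of_pos hu.1]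
    have h2 : IntervalIntegrable (fun u : ℝ => u ^ (-(5/6) : ℝ)) volume 0 1 :=
      intervalIntegral.intervalIntegrable_rpow' (by norm_num)
    rw [h1, ← ofReal_integral_eq_lintegral_ofReal]
    · rw [← intervalIntegral.integral_of_le zero_le_one, integral_rpow (by left; norm_num)]
      norm_num
    · exact (intervalIntegrable_iff_integrableOn_Ioc_of_le zero_le_one).1 h2
    · refine (ae_restrict_iff' measurableSet_Ioc).2 (Filter.Eventually.of_forall fun u hu => ?_)
      exact Real.rpow_nonneg hu.1.le _
  have hneg : ∫⁻ u in Set.Ico (-1:ℝ) 0, ENNReal.ofReal |u| ^ (-(5/6) : ℝ) = ENNReal.ofReal 6 := by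
    rw [← hpos]
    have := (Measure.measurePreserving_neg (volume : Measure ℝ)).setLIntegral_comp_preimage_emb
      (MeasurableEquiv.neg ℝ).measurableEmbedding (fun u => ENNReal.ofReal |u| ^ (-(5/6) : ℝ)) (Set.Ioc (0:ℝ) 1)
    rw [← this]
    simp
  have hsub : Set.Icc (-1:ℝ) 1 ⊆ Set.Ico (-1:ℝ) 0 ∪ ({0} ∪ Set.Ioc (0:ℝ) 1) := by
    intro u hu
    rcases lt_trichotomy u 0 with h | h | h
    · left; exact ⟨hu.1, h⟩
    · right; left; exact h
    · right; right; exact ⟨h, hu.2⟩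
  have : ∫⁻ u in Set.Icc (-1:ℝ) 1, ENNReal.ofReal |u| ^ (-(5/6) : ℝ) ≤ ENNReal.ofReal 12 := by
    refine (lintegral_mono_set hsub).trans ((lintegral_union_le _ _ _).trans ?_)
    refine (add_le_add_right (lintegral_union_le _ _ _) _).trans ?_
    rw [hneg, hpos]
    simp only [Measure.restrict_singleton, Real.volume_singleton, zero_smul, lintegral_zero_measure, zero_add]
    rw [← ENNReal.ofReal_add (by norm_num) (by norm_num)]
    norm_num
  rw [mul_comm (12:ℝ), ENNReal.ofReal_mul (by positivity)]
  gcongr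

lemma min_le_mw (R u : ℝ) (hR : 0 < R) (A : ENNReal) (h1 : A ≤ ENNReal.ofReal R)
    (h2 : u ≠ 0 → A ≤ ENNReal.ofReal (1 / |u|)) : A ≤ mw R u := by
  by_cases hu : u = 0
  · subst hu
    unfold mw
    rw [abs_zero, ENNReal.ofReal_zero, ENNReal.zero_rpow_of_neg (by norm_num), ENNReal.mul_top]
    · exact le_top
    · simp; positivity
  · have hu' : 0 < |u| := abs_pos.2 hu
    have e : A = A ^ (1/6:ℝ) * A ^ (5/6:ℝ) := by
      rw [← ENNReal.rpow_add_of_nonneg _ _ (by norm_num) (by norm_num)]; norm_num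
    rw [e]
    unfold mw
    refine mul_le_mul' ?_ ?_
    · rw [← ENNReal.ofReal_rpow_of_pos hR]; gcongr
    · rw [ENNReal.rpow_neg, ← ENNReal.inv_rpow, ← ENNReal.ofReal_inv_of_pos hu', ← one_div]
      have := h2 hu
      gcongr

/-- the two-variable integral -/
lemma two_var (R x y α β : ℝ) (hR : 0 < R) :
    ∫⁻ q in Set.Icc (0:ℝ) 1, ∫⁻ r in Set.Icc (0:ℝ) 1, gk R (α - q - r) * gk R (β - x * q - y * r) ≤ mw R (y - x) := by
  have hm : ∀ s, ∫⁻ q in Set.Icc (0:ℝ) 1, gk R (β - x * q - y * (s - q)) ≤ mw R (y - x) := by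
    intro s
    apply min_le_mw R _ hR
    · calc _ ≤ ∫⁻ q in Set.Icc (0:ℝ) 1, ENNReal.ofReal R := lintegral_mono fun q => gk_le _ _ hR
        _ = _ := by simp
    · intro h
      rw [← gk_lint_lin R (y - x) (β - y * s) hR h]
      refine (setLIntegral_le_lintegral _ _).trans (le_of_eq ?_)
      refine lintegral_congr fun q => ?_
      congr 1; ring
  calc _ ≤ ∫⁻ q in Set.Icc (0:ℝ) 1, ∫⁻ r, gk R (α - q - r) * gk R (β - x * q - y * r) :=
        lintegral_mono fun q => setLIntegral_le_lintegral _ _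
    _ = ∫⁻ q in Set.Icc (0:ℝ) 1, ∫⁻ s, gk R (α - s) * gk R (β - x * q - y * (s - q)) := by
        refine lintegral_congr fun q => ?_
        rw [← lintegral_sub_right_eq_self _ q]
        refine lintegral_congr fun s => ?_
        congr 2; ring
    _ = ∫⁻ s, ∫⁻ q in Set.Icc (0:ℝ) 1, gk R (α - s) * gk R (β - x * q - y * (s - q)) := by
        rw [lintegral_lintegral_swap]
        apply Measurable.aemeasurable
        fun_prop
    _ ≤ ∫⁻ s, gk R (α - s) * mw R (y - x) := by
        refine lintegral_mono fun s => ?_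
        simp only
        rw [lintegral_const_mul _ (by fun_prop)]
        gcongr
        exact hm s
    _ = _ := by
        rw [lintegral_mul_const _ (by fun_prop), gk_lint_neg R α hR, one_mul]

/-- first-coordinate integral -/
lemma one_var (R x : ℝ) (hR : 1 ≤ R) :
    ∫⁻ y in Set.Icc (0:ℝ) 1, ∫⁻ x' in Set.Icc (0:ℝ) 1, ∫⁻ y' in Set.Icc (0:ℝ) 1,
      gk R (x + y - x' - y') * gk R (x^2 + y^2 - x'^2 - y'^2) * mw R (y' - x') ≤
    ENNReal.ofReal (12 * Real.exp Real.pi * R ^ (2/3 : ℝ)) := by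
  have hR0 : 0 < R := by linarith
  calc _ ≤ ∫⁻ y, ∫⁻ x', ∫⁻ u in Set.Icc (-1:ℝ) 1,
      gk R (x + y - x' - (x'+u)) * gk R (x^2 + y^2 - x'^2 - (x'+u)^2) * mw R u := by
        refine (setLIntegral_le_lintegral _ _).trans (lintegral_mono fun y => ?_)
        rw [← lintegral_indicator measurableSet_Icc]
        refine lintegral_mono fun x' => ?_
        simp only
        by_cases hx : x' ∈ Set.Icc (0:ℝ) 1
        · rw [Set.indicator_of_mem hx, ← lintegral_indicator measurableSet_Icc, ← lintegral_indicator measurableSet_Icc,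
            ← lintegral_add_left_eq_self _ x']
          refine lintegral_mono fun u => ?_
          simp only
          by_cases hu : x' + u ∈ Set.Icc (0:ℝ) 1
          · rw [Set.indicator_of_mem hu, Set.indicator_of_mem]
            · simp
            · constructor <;> linarith [hx.1, hx.2, hu.1, hu.2]
          · rw [Set.indicator_of_notMem hu]; exact zero_le
        · rw [Set.indicator_of_notMem hx]; exact zero_le
    _ = ∫⁻ u in Set.Icc (-1:ℝ) 1, ∫⁻ x', ∫⁻ y,
      gk R (x + y - x' - (x'+u)) * gk R (x^2 + y^2 - x'^2 - (x'+u)^2) * mw R u := by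
        rw [lintegral_lintegral_swap]
        · rw [lintegral_lintegral_swap (μ := volume.restrict (Set.Icc (-1:ℝ) 1))]
          · refine lintegral_congr fun x' => ?_
            rw [lintegral_lintegral_swap]
            apply Measurable.aemeasurable
            fun_prop
          · apply Measurable.aemeasurable
            apply Measurable.lintegral_prod_right'
              (f := fun z : (ℝ × ℝ) × ℝ => gk R (x + z.2 - z.1.2 - (z.1.2+z.1.1)) * gk R (x^2 + z.2^2 - z.1.2^2 - (z.1.2+z.1.1)^2) * mw R z.1.1)
            fun_prop
        · apply Measurable.aemeasurable
          apply Measurable.lintegral_prod_right'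
              (f := fun z : (ℝ × ℝ) × ℝ => gk R (x + z.1.1 - z.1.2 - (z.1.2+z.2)) * gk R (x^2 + z.1.1^2 - z.1.2^2 - (z.1.2+z.2)^2) * mw R z.2)
          fun_prop
    _ ≤ ∫⁻ u in Set.Icc (-1:ℝ) 1, ENNReal.ofReal (Real.exp Real.pi * Real.sqrt R) * mw R u := by
        refine lintegral_mono fun u => ?_
        simp only
        calc _ = ∫⁻ x', ∫⁻ z, gk R (z + (x - u)) * gk R (2 * x'^2 + (4 * z - 2 * u) * x' + (x^2 + z^2 - u^2)) * mw R u := by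
              refine lintegral_congr fun x' => ?_
              rw [← lintegral_add_left_eq_self _ (2*x')]
              refine lintegral_congr fun z => ?_
              congr 3 <;> ring
          _ = ∫⁻ z, ∫⁻ x', gk R (z + (x - u)) * gk R (2 * x'^2 + (4 * z - 2 * u) * x' + (x^2 + z^2 - u^2)) * mw R u := by
              rw [lintegral_lintegral_swap]
              apply Measurable.aemeasurable
              fun_prop
          _ ≤ ∫⁻ z, gk R (z + (x - u)) * (ENNReal.ofReal (Real.exp Real.pi * Real.sqrt R) * mw R u) := by
              refine lintegral_mono fun z => ?_
              simp only [mul_assoc]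
              rw [lintegral_const_mul _ (by fun_prop), lintegral_mul_const _ (by fun_prop), ← mul_assoc]
              have := gk_quad R (4 * z - 2 * u) (x^2 + z^2 - u^2) hR0
              rw [mul_assoc]
              gcongr
          _ = _ := by
              rw [lintegral_mul_const _ (by fun_prop), gk_lint_shift R _ hR0, one_mul]
    _ ≤ ENNReal.ofReal (Real.exp Real.pi * Real.sqrt R) * ENNReal.ofReal (12 * R ^ (1/6 : ℝ)) := by
        rw [lintegral_const_mul _ (by fun_prop)]
        gcongr
        exact mw_lint R hR
    _ = _ := by
        rw [← ENNReal.ofReal_mul (by positivity)]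
        congr 1
        rw [Real.sqrt_eq_rpow]
        have : R ^ (2/3:ℝ) = R ^ (1/2:ℝ) * R ^ (1/6:ℝ) := by
          rw [← Real.rpow_add hR0]; norm_num
        rw [this]; ring

lemma schur {Y : Type*} [MeasurableSpace Y] (ν : Measure Y) [SFinite ν] (G : Y → ENNReal)
    (hG : AEMeasurable G ν) (K : Y → Y → ENNReal) (hK : Measurable (Function.uncurry K))
    (hs : ∀ y y', K y y' = K y' y) :
    ∫⁻ y, ∫⁻ y', G y * G y' * K y y' ∂ν ∂ν ≤ ∫⁻ y, G y ^ 2 * ∫⁻ y', K y y' ∂ν ∂ν := by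
  have hKr : ∀ y, Measurable (K y) := fun y => hK.comp (measurable_const.prodMk measurable_id)
  have e1 : ∫⁻ y, ∫⁻ y', G y ^ 2 * K y y' ∂ν ∂ν = ∫⁻ y, G y ^ 2 * ∫⁻ y', K y y' ∂ν ∂ν := by
    refine lintegral_congr fun y => ?_
    rw [lintegral_const_mul _ (hKr y)]
  have e2 : ∫⁻ y, ∫⁻ y', G y' ^ 2 * K y y' ∂ν ∂ν = ∫⁻ y, G y ^ 2 * ∫⁻ y', K y y' ∂ν ∂ν := by
    rw [← e1, lintegral_lintegral_swap]
    · refine lintegral_congr fun y => lintegral_congr fun y' => ?_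
      rw [hs]
    · exact ((hG.comp_snd).pow_const 2).mul hK.aemeasurable
  have h2 : 2 * ∫⁻ y, ∫⁻ y', G y * G y' * K y y' ∂ν ∂ν ≤ 2 * ∫⁻ y, G y ^ 2 * ∫⁻ y', K y y' ∂ν ∂ν := by
    rw [two_mul (∫⁻ y, G y ^ 2 * ∫⁻ y', K y y' ∂ν ∂ν)]
    nth_rw 1 [← e1]
    rw [← e2, ← lintegral_const_mul' _ _ (by norm_num), ← lintegral_add_left']
    · refine lintegral_mono fun y => ?_
      simp only
      rw [← lintegral_const_mul' _ _ (by norm_num), ← lintegral_add_left ((hKr y).const_mul _)]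
      refine lintegral_mono fun y' => ?_
      simp only
      rw [← add_mul, ← mul_assoc]
      gcongr
      generalize G y = a
      generalize G y' = b
      rcases eq_or_ne a ⊤ with h | h
      · simp [h]
      rcases eq_or_ne b ⊤ with h' | h'
      · simp [h']
      lift a to NNReal using h
      lift b to NNReal using h'
      norm_cast
      have := two_mul_le_add_sq a b
      rwa [← mul_assoc]
    · rw [show (fun y => ∫⁻ y', G y ^ 2 * K y y' ∂ν) = fun y => G y ^ 2 * ∫⁻ y', K y y' ∂ν from
        funext fun y => lintegral_const_mul _ (hKr y)]
      exact (hG.pow_const 2).mul (hK.lintegral_prod_right').aemeasurable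
  exact (ENNReal.mul_le_mul_iff_right (by norm_num) (by norm_num)).1 h2

def stripA (J : Set ℝ) : Set (Fin 3 → ℝ) := {ξ : Fin 3 → ℝ | ξ 2 ∈ J} ∩ cube3

def rhoQ (J : Set ℝ) : Measure (ℝ × ℝ) := (volume.restrict (Set.Icc (0:ℝ) 1)).prod (volume.restrict J)

instance (J : Set ℝ) : SFinite (rhoQ J) := by unfold rhoQ; infer_instance

lemma lint_strip (J : Set ℝ) (hJ : J ⊆ Set.Icc 0 1) (G : (Fin 3 → ℝ) → ENNReal) (hG : Measurable G) :
    ∫⁻ ξ in stripA J, G ξ = ∫⁻ q, (∫⁻ b in Set.Icc (0:ℝ) 1, G ![q.1, b, q.2]) ∂(rhoQ J) := by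
  set S : Fin 3 → Set ℝ := ![Set.Icc 0 1, Set.Icc 0 1, J] with hS
  have hA : stripA J = Set.univ.pi S := by
    ext ξ
    simp only [stripA, cube3, Set.mem_inter_iff, Set.mem_ofPred_eq, Set.mem_Icc, Pi.le_def, Set.mem_pi, Set.mem_univ, true_imp_iff, hS]
    rw [Fin.forall_fin_succ, Fin.forall_fin_succ, Fin.forall_fin_succ]
    simp [Fin.forall_fin_succ]
    constructor
    · tauto
    · rintro ⟨h1, h2, h3⟩
      have := hJ h3
      simp at this
      tauto
  have hvol : (volume : Measure (Fin 3 → ℝ)).restrict (stripA J) = Measure.pi (fun i => volume.restrict (S i)) := by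
    rw [hA, volume_pi, Measure.restrict_pi_pi]
  rw [hvol]
  have m1 := measurePreserving_piFinSuccAbove (fun i : Fin 3 => (volume : Measure ℝ).restrict (S i)) 1
  have m2 := measurePreserving_piFinTwo (fun j : Fin 2 => (volume : Measure ℝ).restrict (S ((1 : Fin 3).succAbove j)))
  have h1 := (m1.symm).lintegral_comp hG
  rw [← h1, lintegral_prod_symm' _ (by fun_prop)]
  have hm : Measurable fun q : ℝ × ℝ => ∫⁻ b in Set.Icc (0:ℝ) 1, G ![q.1, b, q.2] := by
    apply Measurable.lintegral_prod_right' (f := fun z : (ℝ × ℝ) × ℝ => G ![z.1.1, z.2, z.1.2])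
    apply hG.comp
    rw [measurable_pi_iff]
    intro i
    fin_cases i <;> simp <;> fun_prop
  have h2 := m2.lintegral_comp hm
  have h3 : (Measure.restrict volume (S ((1 : Fin 3).succAbove 0))).prod (Measure.restrict volume (S ((1 : Fin 3).succAbove 1))) = rhoQ J := by
    unfold rhoQ
    rfl
  rw [h3] at h2
  rw [← h2]
  refine lintegral_congr fun r => ?_
  refine lintegral_congr fun b => ?_
  congr 1
  ext i
  fin_cases i <;> rfl

def t4 (ξ η ξ' η' : Fin 3 → ℝ) : ℝ :=
  (ξ 0 * ξ 1 + ξ 2 ^ 2) + (η 0 * η 1 + η 2 ^ 2) - (ξ' 0 * ξ' 1 + ξ' 2 ^ 2) - (η' 0 * η' 1 + η' 2 ^ 2)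

def KK (R : ℝ) (ξ η ξ' η' : Fin 3 → ℝ) : ENNReal :=
  gk R (ξ 0 + η 0 - ξ' 0 - η' 0) * gk R (ξ 1 + η 1 - ξ' 1 - η' 1) * gk R (ξ 2 + η 2 - ξ' 2 - η' 2) *
    gk R (t4 ξ η ξ' η') * gk R (ξ 0 ^ 2 + η 0 ^ 2 - ξ' 0 ^ 2 - η' 0 ^ 2)

lemma KK_meas (R : ℝ) : Measurable fun z : ((Fin 3 → ℝ) × (Fin 3 → ℝ)) × ((Fin 3 → ℝ) × (Fin 3 → ℝ)) =>
    KK R z.1.1 z.1.2 z.2.1 z.2.2 := by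
  unfold KK t4
  fun_prop

lemma meas_vec {α : Type*} [MeasurableSpace α] (a b c : α → ℝ) (ha : Measurable a) (hb : Measurable b) (hc : Measurable c) :
    Measurable fun z => (![a z, b z, c z] : Fin 3 → ℝ) := by
  rw [measurable_pi_iff]
  intro i
  fin_cases i <;> simpa

lemma KK_meas' {α : Type*} [MeasurableSpace α] (R : ℝ) (a b c d : α → Fin 3 → ℝ) (ha : Measurable a) (hb : Measurable b)
    (hc : Measurable c) (hd : Measurable d) : Measurable fun z => KK R (a z) (b z) (c z) (d z) := by
  unfold KK t4
  fun_prop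

lemma count1 (R : ℝ) (hR : 0 < R) (J : Set ℝ) (hJ : J ⊆ Set.Icc 0 1) (ξ η : Fin 3 → ℝ) :
    ∫⁻ ξ' in stripA J, ∫⁻ η' in stripA J, KK R ξ η ξ' η' ≤
    ∫⁻ q, ∫⁻ r, gk R (ξ 0 + η 0 - q.1 - r.1) * gk R (ξ 0 ^ 2 + η 0 ^ 2 - q.1 ^ 2 - r.1 ^ 2) * mw R (r.1 - q.1) *
      gk R (ξ 2 + η 2 - q.2 - r.2) ∂(rhoQ J) ∂(rhoQ J) := by
  rw [lint_strip J hJ]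
  swap
  · apply Measurable.lintegral_prod_right' (f := fun z : (Fin 3 → ℝ) × (Fin 3 → ℝ) => KK R ξ η z.1 z.2)
    apply KK_meas' <;> fun_prop
  refine lintegral_mono fun q => ?_
  calc _ = ∫⁻ b in Set.Icc (0:ℝ) 1, ∫⁻ r, (∫⁻ d in Set.Icc (0:ℝ) 1, KK R ξ η ![q.1, b, q.2] ![r.1, d, r.2]) ∂(rhoQ J) := by
        refine lintegral_congr fun b => ?_
        rw [lint_strip J hJ]
        apply KK_meas' <;> fun_prop
    _ = ∫⁻ r, (∫⁻ b in Set.Icc (0:ℝ) 1, ∫⁻ d in Set.Icc (0:ℝ) 1, KK R ξ η ![q.1, b, q.2] ![r.1, d, r.2]) ∂(rhoQ J) := by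
        rw [lintegral_lintegral_swap]
        apply Measurable.aemeasurable
        apply Measurable.lintegral_prod_right' (f := fun z : (ℝ × (ℝ × ℝ)) × ℝ => KK R ξ η ![q.1, z.1.1, q.2] ![z.1.2.1, z.2, z.1.2.2])
        apply KK_meas'
        · fun_prop
        · fun_prop
        · apply meas_vec <;> fun_prop
        · apply meas_vec <;> fun_prop
    _ ≤ _ := by
        refine lintegral_mono fun r => ?_
        simp only
        set P := gk R (ξ 0 + η 0 - q.1 - r.1) with hP
        set P5 := gk R (ξ 0 ^ 2 + η 0 ^ 2 - q.1 ^ 2 - r.1 ^ 2) with hP5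
        set P3 := gk R (ξ 2 + η 2 - q.2 - r.2) with hP3
        set β := ξ 0 * ξ 1 + ξ 2 ^ 2 + (η 0 * η 1 + η 2 ^ 2) - q.2^2 - r.2^2 with hβ
        have h1 : ∀ b d, KK R ξ η ![q.1, b, q.2] ![r.1, d, r.2] = P * P5 * P3 *
            (gk R ((ξ 1 + η 1) - b - d) * gk R (β - q.1 * b - r.1 * d)) := by
          intro b d
          have : β - q.1 * b - r.1 * d = t4 ξ η ![q.1, b, q.2] ![r.1, d, r.2] := by
            simp [t4, hβ]; ring
          rw [this]
          simp [KK, hP, hP3, hP5]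
          ring
        have hfin : ∀ t, gk R t ≠ ⊤ := fun t => ENNReal.ofReal_ne_top
        simp_rw [h1]
        have h2 : ∀ b, ∫⁻ d in Set.Icc (0:ℝ) 1, P * P5 * P3 * (gk R ((ξ 1 + η 1) - b - d) * gk R (β - q.1 * b - r.1 * d)) =
            P * P5 * P3 * ∫⁻ d in Set.Icc (0:ℝ) 1, (gk R ((ξ 1 + η 1) - b - d) * gk R (β - q.1 * b - r.1 * d)) := by
          intro b
          rw [lintegral_const_mul _ (by fun_prop)]
        simp_rw [h2]
        rw [lintegral_const_mul' _ _ (ENNReal.mul_ne_top (ENNReal.mul_ne_top (hfin _) (hfin _)) (hfin _))]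
        have := two_var R q.1 r.1 (ξ 1 + η 1) β hR
        calc _ ≤ P * P5 * P3 * mw R (r.1 - q.1) := by gcongr
          _ = _ := by ring

lemma count2 (R : ℝ) (hR : 1 ≤ R) (J : Set ℝ) (hJ : J ⊆ Set.Icc 0 1)  (ξ : Fin 3 → ℝ) :
    ∫⁻ η in stripA J, ∫⁻ ξ' in stripA J, ∫⁻ η' in stripA J, KK R ξ η ξ' η' ≤
    ENNReal.ofReal (12 * Real.exp Real.pi * R ^ (2/3 : ℝ)) * (volume J) ^ 2 := by
  have hR0 : 0 < R := by linarith
  have hprod : ∀ F : ℝ × ℝ → ENNReal, ∀ C : ENNReal, ∀ f : ℝ → ENNReal, Measurable f → Measurable F →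
      (∀ a, ∫⁻ c in J, F (a, c) ≤ f a * C) → ∫⁻ q, F q ∂(rhoQ J) ≤ (∫⁻ a in Set.Icc (0:ℝ) 1, f a) * C := by
    intro F C f hf hF h
    unfold rhoQ
    rw [lintegral_prod _ hF.aemeasurable, ← lintegral_mul_const _ hf]
    exact lintegral_mono h
  have hmeas : Measurable fun z : (ℝ × ℝ) × (ℝ × ℝ) × (ℝ × ℝ) => 
      gk R (ξ 0 + z.1.1 - z.2.1.1 - z.2.2.1) * gk R (ξ 0 ^ 2 + z.1.1 ^ 2 - z.2.1.1 ^ 2 - z.2.2.1 ^ 2) * mw R (z.2.2.1 - z.2.1.1) *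
      gk R (ξ 2 + z.1.2 - z.2.1.2 - z.2.2.2) := by
    fun_prop
  set f0 : ℝ → ℝ → ℝ → ENNReal := fun y x' y' => gk R (ξ 0 + y - x' - y') * gk R (ξ 0 ^2 + y^2 - x'^2 - y'^2) * mw R (y' - x') with hf0
  have hf0m : Measurable fun z : ℝ × ℝ × ℝ => f0 z.1 z.2.1 z.2.2 := by
    simp only [hf0]; fun_prop
  have hf1m : Measurable fun z : ℝ × ℝ => ∫⁻ y' in Set.Icc (0:ℝ) 1, f0 z.1 z.2 y' := by
    apply Measurable.lintegral_prod_right' (f := fun z : (ℝ × ℝ) × ℝ => f0 z.1.1 z.1.2 z.2)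
    exact hf0m.comp (f := fun z : (ℝ × ℝ) × ℝ => (z.1.1, z.1.2, z.2)) (by fun_prop)
  have hf2m : Measurable fun y : ℝ => ∫⁻ x' in Set.Icc (0:ℝ) 1, ∫⁻ y' in Set.Icc (0:ℝ) 1, f0 y x' y' := 
    Measurable.lintegral_prod_right' (f := fun z : ℝ × ℝ => ∫⁻ y' in Set.Icc (0:ℝ) 1, f0 z.1 z.2 y') hf1m
  -- innermost
  have s1 : ∀ y y3 : ℝ, ∀ q : ℝ × ℝ, ∫⁻ r, f0 y q.1 r.1 * gk R (ξ 2 + y3 - q.2 - r.2) ∂(rhoQ J) ≤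
      ∫⁻ y' in Set.Icc (0:ℝ) 1, f0 y q.1 y' := by
    intro y y3 q
    rw [← mul_one (∫⁻ y' in Set.Icc (0:ℝ) 1, f0 y q.1 y')]
    apply hprod
    · exact hf0m.comp (f := fun y' => (y, q.1, y')) (by fun_prop)
    · simp only [hf0]; fun_prop
    · intro a
      simp only
      rw [lintegral_const_mul _ (by fun_prop)]
      gcongr
      rw [← gk_lint_neg R (ξ 2 + y3 - q.2) hR0]
      exact setLIntegral_le_lintegral _ _
  have s2 : ∀ y y3 : ℝ, ∫⁻ q, ∫⁻ r, f0 y q.1 r.1 * gk R (ξ 2 + y3 - q.2 - r.2) ∂(rhoQ J) ∂(rhoQ J) ≤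
      (∫⁻ x' in Set.Icc (0:ℝ) 1, ∫⁻ y' in Set.Icc (0:ℝ) 1, f0 y x' y') * volume J := by
    intro y y3
    refine (lintegral_mono (s1 y y3)).trans ?_
    apply hprod
    · exact hf1m.comp (f := fun x' => (y, x')) (by fun_prop)
    · exact hf1m.comp (f := fun q : ℝ × ℝ => (y, q.1)) (by fun_prop)
    · intro a
      simp
  calc _ ≤ ∫⁻ η in stripA J, (∫⁻ x' in Set.Icc (0:ℝ) 1, ∫⁻ y' in Set.Icc (0:ℝ) 1, f0 (η 0) x' y') * volume J := by
        refine lintegral_mono fun η => ?_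
        exact (count1 R hR0 J hJ ξ η).trans (s2 (η 0) (η 2))
    _ ≤ ((∫⁻ y in Set.Icc (0:ℝ) 1, ∫⁻ x' in Set.Icc (0:ℝ) 1, ∫⁻ y' in Set.Icc (0:ℝ) 1, f0 y x' y') * volume J) * volume J := by
        rw [lint_strip J hJ, ← lintegral_mul_const _ hf2m]
        · apply hprod
          · exact hf2m.mul_const _
          · simp
            exact (hf2m.mul_const _).comp measurable_fst
          · intro a
            simp
        · exact (hf2m.mul_const _).comp (measurable_pi_apply 0)
    _ ≤ _ := by
        rw [mul_assoc, ← pow_two]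
        gcongr
        exact one_var R (ξ 0) hR

def Phi (ξ : Fin 3 → ℝ) : V5 := !₂[ξ 0, ξ 1, ξ 2, ξ 0 * ξ 1 + ξ 2 ^ 2, ξ 0 ^ 2]

lemma Phi_meas : Measurable Phi := by
  unfold Phi
  apply (WithLp.measurable_toLp 2 _).comp
  rw [measurable_pi_iff]
  intro i
  fin_cases i <;> simp <;> fun_prop

lemma Phi_inner (ξ : Fin 3 → ℝ) (x : V5) : inner ℝ (Phi ξ) x =
    ξ 0 * x 0 + ξ 1 * x 1 + ξ 2 * x 2 + (ξ 0 * ξ 1 + ξ 2 ^ 2) * x 3 + ξ 0 ^ 2 * x 4 := by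
  rw [PiLp.inner_apply, Fin.sum_univ_five]
  simp [Phi]
  ring

lemma Phi_KK (R : ℝ) (hR : 0 < R) (ξ η ξ' η' : Fin 3 → ℝ) :
    ENNReal.ofReal (R^5 * Real.exp (-Real.pi * R^2 * ‖(Phi ξ + Phi η) - (Phi ξ' + Phi η')‖^2)) = KK R ξ η ξ' η' := by
  unfold KK gk
  rw [← ENNReal.ofReal_mul (by positivity), ← ENNReal.ofReal_mul (by positivity), ← ENNReal.ofReal_mul (by positivity),
    ← ENNReal.ofReal_mul (by positivity)]
  congr 1
  rw [EuclideanSpace.norm_sq_eq, Fin.sum_univ_five]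
  simp only [Phi, Real.norm_eq_abs, sq_abs]
  have : ∀ a b c d e : ℝ, R * Real.exp a * (R * Real.exp b) * (R * Real.exp c) * (R * Real.exp d) * (R * Real.exp e)
      = R^5 * Real.exp (a + b + c + d + e) := by
    intro a b c d e
    simp only [Real.exp_add]; ring
  rw [this]
  congr 2
  simp [t4]
  ring

lemma gk_neg (R t : ℝ) : gk R (-t) = gk R t := by simp [gk]

lemma gk_sw (R s t : ℝ) (h : s = -t) : gk R s = gk R t := by rw [h, gk_neg]

lemma KK_symm (R : ℝ) (ξ η ξ' η' : Fin 3 → ℝ) : KK R ξ η ξ' η' = KK R ξ' η' ξ η := by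
  unfold KK
  rw [gk_sw R (ξ 0 + η 0 - ξ' 0 - η' 0) (ξ' 0 + η' 0 - ξ 0 - η 0) (by ring),
    gk_sw R (ξ 1 + η 1 - ξ' 1 - η' 1) (ξ' 1 + η' 1 - ξ 1 - η 1) (by ring),
    gk_sw R (ξ 2 + η 2 - ξ' 2 - η' 2) (ξ' 2 + η' 2 - ξ 2 - η 2) (by ring),
    gk_sw R (t4 ξ η ξ' η') (t4 ξ' η' ξ η) (by unfold t4; ring),
    gk_sw R (ξ 0 ^ 2 + η 0 ^ 2 - ξ' 0 ^ 2 - η' 0 ^ 2) (ξ' 0 ^ 2 + η' 0 ^ 2 - ξ 0 ^ 2 - η 0 ^ 2) (by ring)]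

lemma KK_symm' (R : ℝ) (ξ η ξ' η' : Fin 3 → ℝ) : KK R ξ η ξ' η' = KK R η ξ ξ' η' := by
  unfold KK t4
  rw [add_comm (ξ 0), add_comm (ξ 1), add_comm (ξ 2), add_comm (ξ 0 * ξ 1 + ξ 2 ^ 2), add_comm (ξ 0 ^ 2)]

lemma L4bound (R : ℝ) (hR : 1 ≤ R) (J : Set ℝ) (hJ : J ⊆ Set.Icc 0 1) (f : (Fin 3 → ℝ) → ℂ)
    (hf : IntegrableOn f (stripA J)) (c : V5) :
    ∫⁻ x in Metric.ball c R, ‖∫ ξ in stripA J, f ξ *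
      Complex.exp (2 * (Real.pi : ℂ) * Complex.I * ((inner ℝ (Phi ξ) x : ℝ) : ℂ))‖ₑ ^ 4 ≤
    ENNReal.ofReal (Real.exp Real.pi) * (ENNReal.ofReal (12 * Real.exp Real.pi * R ^ (2/3 : ℝ)) * (volume J) ^ 2 *
      ∫⁻ ξ in stripA J, ‖f ξ‖ₑ ^ 4) := by
  have hR0 : 0 < R := by linarith
  have hpi := Real.pi_pos
  set μ := (volume : Measure (Fin 3 → ℝ)).restrict (stripA J) with hμ
  set F : V5 → ℂ := fun x => ∫ ξ, f ξ * Complex.exp (2 * (Real.pi : ℂ) * Complex.I * ((inner ℝ (Phi ξ) x : ℝ) : ℂ)) ∂μ with hF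
  set Ψ : (Fin 3 → ℝ) × (Fin 3 → ℝ) → V5 := fun z => Phi z.1 + Phi z.2 with hΨ
  have hΨm : Measurable Ψ := (Phi_meas.comp measurable_fst).add (Phi_meas.comp measurable_snd)
  set h : (Fin 3 → ℝ) × (Fin 3 → ℝ) → ℂ := fun z => f z.1 * f z.2 with hh
  have hhi : Integrable h (μ.prod μ) := Integrable.mul_prod hf hf
  have hsq : ∀ x, F x ^ 2 = ∫ z, h z * Complex.exp (2 * (Real.pi : ℂ) * Complex.I * ((inner ℝ (Ψ z) x : ℝ) : ℂ)) ∂(μ.prod μ) := by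
    intro x
    rw [pow_two]
    simp only [hF]
    rw [← integral_prod_mul]
    congr 1
    ext z
    simp only [hh, hΨ, inner_add_left]
    push_cast
    rw [mul_add, Complex.exp_add]
    ring
  have hfm : AEMeasurable (fun ξ => ‖f ξ‖ₑ) μ := hf.aestronglyMeasurable.enorm
  have hKm : Measurable fun z : (Fin 3 → ℝ) × (Fin 3 → ℝ) => ∫⁻ z', KK R z.1 z.2 z'.1 z'.2 ∂(μ.prod μ) :=
    (KK_meas R).lintegral_prod_right'
  have main : ∫⁻ x, ‖F x‖ₑ ^ 4 * ENNReal.ofReal (Real.exp (-Real.pi / R^2 * ‖x - c‖^2)) ≤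
      ENNReal.ofReal (12 * Real.exp Real.pi * R ^ (2/3 : ℝ)) * (volume J) ^ 2 * ∫⁻ ξ, ‖f ξ‖ₑ ^ 4 ∂μ := by
    calc _ = ∫⁻ x, ‖∫ z, h z * Complex.exp (2 * (Real.pi : ℂ) * Complex.I * ((inner ℝ (Ψ z) x : ℝ) : ℂ)) ∂(μ.prod μ)‖ₑ^2
            * ENNReal.ofReal (Real.exp (-Real.pi / R^2 * ‖x - c‖^2)) := by
          refine lintegral_congr fun x => ?_
          rw [← hsq, enorm_pow, ← pow_mul]
      _ ≤ ∫⁻ z, ∫⁻ z', ‖h z‖ₑ * ‖h z'‖ₑ * KK R z.1 z.2 z'.1 z'.2 ∂(μ.prod μ) ∂(μ.prod μ) := by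
          refine (L2bound (μ.prod μ) h hhi Ψ hΨm c R hR0).trans (le_of_eq ?_)
          refine lintegral_congr fun z => lintegral_congr fun z' => ?_
          rw [← Phi_KK R hR0]
      _ ≤ ∫⁻ z, ‖h z‖ₑ ^ 2 * ∫⁻ z', KK R z.1 z.2 z'.1 z'.2 ∂(μ.prod μ) ∂(μ.prod μ) := by
          apply schur (μ.prod μ) (fun z => ‖h z‖ₑ) hhi.aestronglyMeasurable.enorm (fun z z' => KK R z.1 z.2 z'.1 z'.2) (KK_meas R)
          intro z z'
          exact KK_symm _ _ _ _ _
      _ = ∫⁻ ξ, ∫⁻ η, ‖f ξ‖ₑ ^ 2 * ‖f η‖ₑ ^ 2 * ∫⁻ z', KK R ξ η z'.1 z'.2 ∂(μ.prod μ) ∂μ ∂μ := by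
          rw [lintegral_prod]
          · simp only [hh, enorm_mul, mul_pow]
          · exact (hhi.aestronglyMeasurable.enorm.pow_const 2).mul hKm.aemeasurable
      _ ≤ ∫⁻ ξ, (‖f ξ‖ₑ ^ 2) ^ 2 * ∫⁻ η, ∫⁻ z', KK R ξ η z'.1 z'.2 ∂(μ.prod μ) ∂μ ∂μ := by
          apply schur μ (fun ξ => ‖f ξ‖ₑ ^ 2) (hfm.pow_const 2) (fun ξ η => ∫⁻ z', KK R ξ η z'.1 z'.2 ∂(μ.prod μ)) hKm
          intro ξ η
          simp_rw [KK_symm' R ξ η]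
      _ ≤ ∫⁻ ξ, (‖f ξ‖ₑ ^ 4) * (ENNReal.ofReal (12 * Real.exp Real.pi * R ^ (2/3 : ℝ)) * (volume J) ^ 2) ∂μ := by
          refine lintegral_mono fun ξ => ?_
          simp only
          rw [← pow_mul]
          gcongr
          refine le_trans (le_of_eq ?_) (count2 R hR J hJ ξ)
          refine lintegral_congr fun η => ?_
          rw [lintegral_prod]
          apply Measurable.aemeasurable
          apply KK_meas' <;> fun_prop
      _ = _ := by
          rw [lintegral_mul_const'', mul_comm]
          exact hfm.pow_const 4
  refine le_trans ?_ (mul_le_mul_right main _)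
  rw [← lintegral_const_mul' _ _ ENNReal.ofReal_ne_top]
  refine le_trans ?_ (setLIntegral_le_lintegral (Metric.ball c R) _)
  refine setLIntegral_mono' measurableSet_ball fun x hx => ?_
  rw [mul_left_comm, ← ENNReal.ofReal_mul (by positivity), ← Real.exp_add]
  refine le_mul_of_one_le_right (zero_le) ?_
  rw [ENNReal.one_le_ofReal, Real.one_le_exp_iff]
  rw [Metric.mem_ball, dist_eq_norm] at hx
  have : ‖x - c‖^2 ≤ R^2 := by gcongr
  have h2 : Real.pi / R^2 * ‖x - c‖^2 ≤ Real.pi := by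
    calc _ ≤ Real.pi / R^2 * R^2 := by gcongr
      _ = _ := by field_simp
  rw [neg_div]; linarith

lemma stripA_vol (J : Set ℝ) (hJ : J ⊆ Set.Icc 0 1) : volume (stripA J) = volume J := by
  have := lint_strip J hJ (fun _ => 1) measurable_const
  simpa [rhoQ, Measure.prod_apply] using this

theorem base_induction_second (p : ℝ) (hp : 4 < p) :
    ∃ C : ℝ, 0 < C ∧ ∀ R : ℝ, 1 ≤ R → ∀ b : ℝ,
      Set.Icc b (b + R ^ (-(1:ℝ)/2)) ⊆ Set.Icc (0:ℝ) 1 →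
      ∀ c : EuclideanSpace ℝ (Fin 5), ∀ f : (Fin 3 → ℝ) → ℂ,
        eLpNorm (eD (Set.indicator
            ({ξ : Fin 3 → ℝ | ξ 2 ∈ Set.Icc b (b + R ^ (-(1:ℝ)/2))} ∩ cube3) f))
          (ENNReal.ofReal p) (volume.restrict (Metric.ball c R)) ≤
        ENNReal.ofReal (C * R ^ (-(1:ℝ)/3 + 1/p)) *
          eLpNorm f (ENNReal.ofReal p) (volume.restrict cube3) := by
  have hpi := Real.pi_pos
  set C0 : ℝ := Real.exp Real.pi * (12 * Real.exp Real.pi) with hC0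
  have hC0pos : 0 < C0 := by positivity
  refine ⟨C0 ^ (1/p), by positivity, ?_⟩
  intro R hR b hJ c f
  have hR0 : 0 < R := by linarith
  have hp0 : 0 < p := by linarith
  set J := Set.Icc b (b + R ^ (-(1:ℝ)/2)) with hJdef
  change eLpNorm (eD (Set.indicator (stripA J) f)) _ _ ≤ _
  have hcm : MeasurableSet cube3 := measurableSet_Icc
  have hAm : MeasurableSet (stripA J) := by
    refine MeasurableSet.inter ?_ hcm
    exact measurableSet_Icc.preimage (measurable_pi_apply 2)
  have hsub : stripA J ⊆ cube3 := Set.inter_subset_right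
  have hvolJ : volume J = ENNReal.ofReal (R ^ (-(1:ℝ)/2)) := by
    rw [hJdef, Real.volume_Icc]; congr 1; ring
  have heD : ∀ x, eD (Set.indicator (stripA J) f) x = ∫ ξ in stripA J, f ξ *
      Complex.exp (2 * (Real.pi : ℂ) * Complex.I * ((inner ℝ (Phi ξ) x : ℝ) : ℂ)) := by
    intro x
    unfold eD
    simp_rw [← Phi_inner]
    rw [← Set.inter_eq_self_of_subset_right hsub, ← setIntegral_indicator hAm, Set.inter_eq_self_of_subset_right hsub]
    congr 1
    ext ξ
    by_cases h : ξ ∈ stripA J <;> simp [h]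
  by_cases hfi : IntegrableOn f (stripA J)
  swap
  · have : eD (Set.indicator (stripA J) f) = 0 := by
      ext x
      rw [heD x]
      apply integral_undef
      intro hcon
      apply hfi
      have h2 := hcon.mul_bdd (c := 1) (g := fun ξ => Complex.exp (-(2 * (Real.pi : ℂ) * Complex.I * ((inner ℝ (Phi ξ) x : ℝ) : ℂ)))) 
        (by have := Phi_meas; apply Measurable.aestronglyMeasurable; fun_prop) (Filter.Eventually.of_forall fun ξ => by
          rw [Complex.norm_exp]; simp)
      refine h2.congr (Filter.Eventually.of_forall fun ξ => ?_)
      simp only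
      rw [mul_assoc, ← Complex.exp_add, add_neg_cancel, Complex.exp_zero, mul_one]
    rw [this]
    simp
  set μ := (volume : Measure (Fin 3 → ℝ)).restrict (stripA J) with hμ
  set N := eLpNorm f (ENNReal.ofReal p) μ with hN
  have hNle : N ≤ eLpNorm f (ENNReal.ofReal p) (volume.restrict cube3) :=
    eLpNorm_mono_measure _ (Measure.restrict_mono hsub le_rfl)
  refine le_trans ?_ (mul_le_mul_right hNle _)
  set v := ENNReal.ofReal (R ^ (-(1:ℝ)/2)) with hv
  have hμv : μ Set.univ = v := by
    rw [hμ, Measure.restrict_apply_univ, stripA_vol J hJ, hvolJ]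
  have hpr : (ENNReal.ofReal p).toReal = p := ENNReal.toReal_ofReal hp0.le
  have hL1 : eLpNorm f 1 μ ≤ N * v ^ (1 - 1/p) := by
    have := eLpNorm_le_eLpNorm_mul_rpow_measure_univ (p := 1) (q := ENNReal.ofReal p) (f := f) (μ := μ)
      (by rw [ENNReal.one_le_ofReal]; linarith) hfi.aestronglyMeasurable
    rw [hμv, hpr] at this
    simpa using this
  have hL4 : eLpNorm f 4 μ ≤ N * v ^ (1/4 - 1/p) := by
    have := eLpNorm_le_eLpNorm_mul_rpow_measure_univ (p := 4) (q := ENNReal.ofReal p) (f := f) (μ := μ)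
      (by rw [show (4:ENNReal) = ENNReal.ofReal 4 by simp]; exact ENNReal.ofReal_le_ofReal hp.le) hfi.aestronglyMeasurable
    rw [hμv, hpr] at this
    simpa using this
  set F := eD (Set.indicator (stripA J) f) with hF
  have hsup : ∀ x, ‖F x‖ₑ ≤ N * v ^ (1 - 1/p) := by
    intro x
    refine le_trans ?_ hL1
    rw [heD x, eLpNorm_one_eq_lintegral_enorm]
    refine (enorm_integral_le_lintegral_enorm _).trans (le_of_eq ?_)
    refine lintegral_congr fun ξ => ?_
    rw [enorm_mul]
    have : ‖Complex.exp (2 * (Real.pi : ℂ) * Complex.I * ((inner ℝ (Phi ξ) x : ℝ) : ℂ))‖ₑ = 1 := by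
      rw [← ofReal_norm, Complex.norm_exp]; simp
    rw [this, mul_one]
  have h4 : ∫⁻ ξ, ‖f ξ‖ₑ ^ 4 ∂μ ≤ (N * v ^ (1/4 - 1/p)) ^ (4:ℝ) := by
    have h := eLpNorm_eq_lintegral_rpow_enorm_toReal (p := 4) (f := f) (μ := μ) (by norm_num) (by norm_num)
    have : ∫⁻ ξ, ‖f ξ‖ₑ ^ 4 ∂μ = (eLpNorm f 4 μ) ^ (4:ℝ) := by
      rw [h, ← ENNReal.rpow_mul]
      norm_num
    rw [this]
    gcongr
  have hF4 : ∫⁻ x in Metric.ball c R, ‖F x‖ₑ ^ 4 ≤ ENNReal.ofReal (Real.exp Real.pi) *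
      (ENNReal.ofReal (12 * Real.exp Real.pi * R ^ (2/3 : ℝ)) * v ^ 2 * ∫⁻ ξ, ‖f ξ‖ₑ ^ 4 ∂μ) := by
    have h := L4bound R hR J hJ f hfi c
    rw [hvolJ] at h
    refine le_trans (le_of_eq (lintegral_congr fun x => ?_)) h
    rw [heD x]
  set M := ENNReal.ofReal (C0 * R ^ (-(1:ℝ)/3)) with hM
  have hMv : ENNReal.ofReal (Real.exp Real.pi) * (ENNReal.ofReal (12 * Real.exp Real.pi * R ^ (2/3 : ℝ)) * v ^ 2) = M := by
    rw [hv, hM, ← ENNReal.ofReal_pow (by positivity), ← ENNReal.ofReal_mul (by positivity), ← ENNReal.ofReal_mul (by positivity)]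
    congr 1
    have : R ^ (-(1:ℝ)/3) = R ^ (2/3:ℝ) * (R ^ (-(1:ℝ)/2)) ^ 2 := by
      rw [← Real.rpow_mul_natCast hR0.le, ← Real.rpow_add hR0]; norm_num
    rw [this, hC0]; ring
  have hF4' : ∫⁻ x in Metric.ball c R, ‖F x‖ₑ ^ 4 ≤ M * (N * v ^ (1/4 - 1/p)) ^ (4:ℝ) := by
    refine hF4.trans ?_
    rw [← mul_assoc, hMv]
    gcongr
  have hv0 : v ≠ 0 := by rw [hv, Ne, ENNReal.ofReal_eq_zero, not_le]; positivity
  have hvt : v ≠ ⊤ := ENNReal.ofReal_ne_top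
  have hFp : ∫⁻ x in Metric.ball c R, ‖F x‖ₑ ^ p ≤ N ^ p * (v ^ (p - 4) * M) := by
    calc _ = ∫⁻ x in Metric.ball c R, ‖F x‖ₑ ^ (p-4) * ‖F x‖ₑ ^ 4 := by
          refine lintegral_congr fun x => ?_
          rw [← ENNReal.rpow_natCast, ← ENNReal.rpow_add_of_nonneg _ _ (by linarith) (by norm_num)]
          norm_num
      _ ≤ ∫⁻ x in Metric.ball c R, (N * v ^ (1 - 1/p)) ^ (p-4) * ‖F x‖ₑ ^ 4 := by
          refine lintegral_mono fun x => ?_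
          simp only
          refine mul_le_mul_left (ENNReal.rpow_le_rpow (hsup x) (by linarith)) _
      _ = (N * v ^ (1 - 1/p)) ^ (p-4) * ∫⁻ x in Metric.ball c R, ‖F x‖ₑ ^ 4 := by
          have hmF : Measurable F := by
            have : StronglyMeasurable F := by
              rw [show F = fun x => ∫ ξ, f ξ * Complex.exp (2 * (Real.pi : ℂ) * Complex.I * ((inner ℝ (Phi ξ) x : ℝ) : ℂ)) ∂μ from funext heD]
              have h5 : (fun x => ∫ ξ, f ξ * Complex.exp (2 * (Real.pi : ℂ) * Complex.I * ((inner ℝ (Phi ξ) x : ℝ) : ℂ)) ∂μ) =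
                fun x => ∫ ξ, (hfi.aestronglyMeasurable.mk f) ξ * Complex.exp (2 * (Real.pi : ℂ) * Complex.I * ((inner ℝ (Phi ξ) x : ℝ) : ℂ)) ∂μ := by
                ext x
                refine integral_congr_ae ?_
                filter_upwards [hfi.aestronglyMeasurable.ae_eq_mk] with ξ hξ
                rw [hξ]
              rw [h5]
              apply StronglyMeasurable.integral_prod_right (f := fun (x : V5) ξ => (hfi.aestronglyMeasurable.mk f) ξ * Complex.exp (2 * (Real.pi : ℂ) * Complex.I * ((inner ℝ (Phi ξ) x : ℝ) : ℂ)))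
              apply Measurable.stronglyMeasurable
              have h6 := hfi.aestronglyMeasurable.stronglyMeasurable_mk.measurable
              have := Phi_meas
              apply Measurable.mul
              · exact h6.comp measurable_snd
              · fun_prop
            exact this.measurable
          rw [lintegral_const_mul _ (by fun_prop)]
      _ ≤ (N * v ^ (1 - 1/p)) ^ (p-4) * (M * (N * v ^ (1/4 - 1/p)) ^ (4:ℝ)) := by gcongr
      _ = _ := by
          rw [ENNReal.mul_rpow_of_nonneg _ _ (by linarith), ENNReal.mul_rpow_of_nonneg _ _ (by norm_num), ← ENNReal.rpow_mul, ← ENNReal.rpow_mul]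
          have e1 : N ^ p = N ^ (p-4) * N ^ (4:ℝ) := by
            rw [← ENNReal.rpow_add_of_nonneg _ _ (by linarith) (by norm_num)]; norm_num
          have e2 : v ^ (p-4) = v ^ ((1 - 1/p) * (p-4)) * v ^ ((1/4 - 1/p) * 4) := by
            rw [← ENNReal.rpow_add _ _ hv0 hvt]
            congr 1
            field_simp
            ring
          rw [e1, e2]
          ring
  rw [eLpNorm_eq_lintegral_rpow_enorm_toReal (by simpa using hp0) ENNReal.ofReal_ne_top, hpr]
  have hfin : v ^ (p - 4) * M ≤ ENNReal.ofReal ((C0 ^ (1/p) * R ^ (-(1:ℝ)/3 + 1/p)) ^ p) := by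
    rw [hv, hM, ENNReal.ofReal_rpow_of_pos (by positivity), ← ENNReal.ofReal_mul (by positivity)]
    apply ENNReal.ofReal_le_ofReal
    rw [Real.mul_rpow (by positivity) (by positivity), ← Real.rpow_mul hC0pos.le, ← Real.rpow_mul hR0.le, ← Real.rpow_mul hR0.le,
      one_div_mul_cancel hp0.ne', Real.rpow_one, mul_left_comm, ← Real.rpow_add hR0]
    gcongr
    have e3 : (-(1:ℝ) / 3 + 1 / p) * p = -(1:ℝ) / 3 * p + 1 := by
      field_simp
    rw [e3]
    linarith
  calc (∫⁻ x in Metric.ball c R, ‖F x‖ₑ ^ p) ^ (1/p) ≤ (N ^ p * ENNReal.ofReal ((C0 ^ (1/p) * R ^ (-(1:ℝ)/3 + 1/p)) ^ p)) ^ (1/p) := by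
        gcongr
        exact hFp.trans (by gcongr)
    _ = _ := by
        rw [← ENNReal.ofReal_rpow_of_pos (by positivity), ← ENNReal.mul_rpow_of_nonneg _ _ hp0.le, ← ENNReal.rpow_mul,
          mul_one_div_cancel hp0.ne', ENNReal.rpow_one, mul_comm]
end
end

section
/- Let E be the extension operator of the surface {(ξ₁, ξ₂, ξ₃, ξ₁ξ₂ + ξ₃², ξ₁²) : ξ ∈ [0,1]³} ⊂ ℝ⁵. Let l₁, l₂ > 0 and let Q₁ = [a₁, a₁+l₁] × [0,1] × [b₁, b₁+l₂] and Q₂ = [a₂, a₂+l₁] × [0,1] × [b₂, b₂+l₂] be boxes contained in [0,1]³ that are separated, i.e. |a₁ − a₂| ≥ 5l₁ and |b₁ − b₂| ≥ 5l₂. Then for every p ≥ 4 there is a constant C_p such that ‖ |E(f₁·1_{Q₁})|^{1/2} |E(f₂·1_{Q₂})|^{1/2} ‖_{L^p(ℝ⁵)} ≤ C_p (l₁l₂)^{1 − 4/p} ‖f₁‖_{L^p(Q₁)}^{1/2} ‖f₂‖_{L^p(Q₂)}^{1/2} for all f₁, f₂. -/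
open MeasureTheory

noncomputable section

/-- The box `[a, a+l₁] × [0,1] × [b, b+l₂] ⊂ [0,1]³`. -/
def box (a l₁ b l₂ : ℝ) : Set (Fin 3 → ℝ) :=
  {ξ : Fin 3 → ℝ | ξ 0 ∈ Set.Icc a (a + l₁) ∧ ξ 1 ∈ Set.Icc (0:ℝ) 1 ∧
    ξ 2 ∈ Set.Icc b (b + l₂)}


open FourierTransform SchwartzMap in
theorem plancherel_aux (G : EuclideanSpace ℝ (Fin 5) → ℂ) (h1 : Integrable G) (h2 : MemLp G 2) :
    ∫⁻ X, ‖𝓕 G X‖ₑ ^ 2 = ∫⁻ u, ‖G u‖ₑ ^ 2 := by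
  set g := h2.toLp G with hg
  have hae : ∀ᵐ x, (𝓕 g : Lp (α := EuclideanSpace ℝ (Fin 5)) ℂ 2 volume) x = 𝓕 G x := by
    apply ae_eq_of_integral_contDiff_smul_eq
    · exact (Lp.memLp _).locallyIntegrable (by norm_num)
    · have : Continuous (𝓕 G) := by
        have := VectorFourier.fourierIntegral_continuous (L := innerₗ (EuclideanSpace ℝ (Fin 5)))
          Real.continuous_fourierChar continuous_inner h1
        exact this
      exact this.locallyIntegrable
    · intro ψ hψ hψc
      have hc' : HasCompactSupport (fun x => (ψ x : ℂ)) := hψc.comp_left (g := Complex.ofReal) (by simp)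
      have hs' : ContDiff ℝ (⊤ : ℕ∞) (fun x => (ψ x : ℂ)) := Complex.ofRealCLM.contDiff.comp hψ
      set P : 𝓢(EuclideanSpace ℝ (Fin 5), ℂ) := hc'.toSchwartzMap hs' with hP
      have hPx : ∀ x, P x = (ψ x : ℂ) := fun x => rfl
      have h := congrArg (fun T => T P) (Lp.fourier_toTemperedDistribution_eq g)
      simp only [TemperedDistribution.fourier_apply, Lp.toTemperedDistribution_apply] at h
      have e1 : ∫ x, ψ x • (𝓕 g : Lp (α := EuclideanSpace ℝ (Fin 5)) ℂ 2 volume) x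
          = ∫ x, P x • (𝓕 g : Lp (α := EuclideanSpace ℝ (Fin 5)) ℂ 2 volume) x := by
        simp [hPx]
      rw [e1, ← h]
      have e2 : ∫ x, (𝓕 P) x • g x = ∫ x, (𝓕 (P : EuclideanSpace ℝ (Fin 5) → ℂ)) x • G x := by
        apply integral_congr_ae
        filter_upwards [h2.coeFn_toLp] with x hx
        rw [SchwartzMap.fourier_coe, hg, hx]
      rw [e2]
      have e3 := VectorFourier.integral_fourierIntegral_smul_eq_flip (L := innerₗ (EuclideanSpace ℝ (Fin 5)))
          Real.continuous_fourierChar continuous_inner (P.integrable (μ := volume)) h1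
      rw [flip_innerₗ] at e3
      refine e3.trans ?_
      apply integral_congr_ae
      filter_upwards with x
      rw [hPx]; simp; left; rfl
  have n1 := Lp.norm_fourier_eq g
  have n2 : eLpNorm (𝓕 g : Lp (α := EuclideanSpace ℝ (Fin 5)) ℂ 2 volume) 2 volume = eLpNorm G 2 volume := by
    rw [Lp.norm_def, Lp.norm_def, ENNReal.toReal_eq_toReal_iff' (Lp.eLpNorm_ne_top _) (Lp.eLpNorm_ne_top _)] at n1
    rw [n1]
    exact eLpNorm_congr_ae h2.coeFn_toLp
  rw [eLpNorm_congr_ae hae] at n2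
  have key : ∀ f : EuclideanSpace ℝ (Fin 5) → ℂ, ∫⁻ X, ‖f X‖ₑ ^ 2 = eLpNorm f 2 volume ^ 2 := by
    intro f
    have := eLpNorm_nnreal_pow_eq_lintegral (f := f) (μ := volume) (p := 2) (by norm_num)
    simpa using this.symm
  rw [key, key]
  exact congrArg (· ^ 2) n2

open FourierTransform in
theorem plancherel_ext (G : EuclideanSpace ℝ (Fin 5) → ℂ) (h1 : Integrable G) (h2 : MemLp G 2) :
    ∫⁻ X : EuclideanSpace ℝ (Fin 5), ‖∫ u, G u * Complex.exp (2 * (Real.pi : ℂ) * Complex.I *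
      ((inner ℝ u X : ℝ) : ℂ))‖ₑ ^ 2 = ∫⁻ u, ‖G u‖ₑ ^ 2 := by
  rw [← plancherel_aux G h1 h2, ← lintegral_neg_eq_self]
  congr with X
  congr 2
  rw [Real.fourier_eq']
  congr with u
  rw [smul_eq_mul, mul_comm]
  congr 2
  simp
  ring

theorem change_var_ext (S : Set (EuclideanSpace ℝ (Fin 5))) (hS : MeasurableSet S)
    (hSf : volume S ≠ ⊤)
    (φ : EuclideanSpace ℝ (Fin 5) → EuclideanSpace ℝ (Fin 5))
    (φ' : EuclideanSpace ℝ (Fin 5) → EuclideanSpace ℝ (Fin 5) →L[ℝ] EuclideanSpace ℝ (Fin 5))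
    (hφ : ∀ x, HasFDerivAt φ (φ' x) x) (hinj : Set.InjOn φ S)
    (J : EuclideanSpace ℝ (Fin 5) → ℝ) (hJm : Measurable J) (hJ : ∀ x, |(φ' x).det| = J x)
    (c : ℝ) (hc : 0 < c) (hJc : ∀ x ∈ S, c ≤ J x)
    (F : EuclideanSpace ℝ (Fin 5) → ℂ) (hF : Measurable F) :
    ∫⁻ X : EuclideanSpace ℝ (Fin 5), ‖∫ s in S, F s * Complex.exp (2 * (Real.pi : ℂ) * Complex.I *
      ((inner ℝ (φ s) X : ℝ) : ℂ))‖ₑ ^ 2 ≤ ENNReal.ofReal (1 / c) * ∫⁻ s in S, ‖F s‖ₑ ^ 2 := by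
  by_cases hfin : ∫⁻ s in S, ‖F s‖ₑ ^ 2 = ⊤
  · rw [hfin, ENNReal.mul_top]
    · exact le_top
    · simpa using hc
  have hd : ∀ x ∈ S, HasFDerivWithinAt φ (φ' x) S x := fun x _ => (hφ x).hasFDerivWithinAt
  have hcont : ContinuousOn φ S := fun x hx => (hφ x).continuousAt.continuousWithinAt
  have hemb := hcont.measurableEmbedding hS hinj
  have himg : MeasurableSet (φ '' S) := hS.image_of_continuousOn_injOn hcont hinj
  obtain ⟨g, hgm, hg⟩ := hemb.exists_stronglyMeasurable_extend
    (f := fun s : S => F s / (J s : ℂ))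
    (Measurable.stronglyMeasurable (by fun_prop)) (fun _ => ⟨0⟩)
  have hgφ : ∀ s ∈ S, g (φ s) = F s / (J s : ℂ) := fun s hs => congrFun hg ⟨s, hs⟩
  have hJpos : ∀ s ∈ S, 0 < J s := fun s hs => hc.trans_le (hJc s hs)
  set G := (φ '' S).indicator g with hGdef
  have memF2 : MemLp F 2 (volume.restrict S) := by
    refine ⟨hF.aestronglyMeasurable, ?_⟩
    have := eLpNorm_nnreal_pow_eq_lintegral (f := F) (μ := volume.restrict S) (p := 2) (by norm_num)
    by_contra hcon
    simp only [not_lt, top_le_iff] at hcon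
    apply hfin
    simp [hcon] at this
    simpa using this.symm
  have : IsFiniteMeasure (volume.restrict S) := ⟨by simpa using hSf.lt_top⟩
  have intF : IntegrableOn F S := memF2.integrable (by norm_num)
  have intG : Integrable G := by
    rw [hGdef, integrable_indicator_iff himg,
      integrableOn_image_iff_integrableOn_abs_det_fderiv_smul volume hS hd hinj]
    refine intF.congr_fun (fun s hs => ?_) hS
    simp only [hJ, hgφ s hs, Complex.real_smul]
    have : (J s : ℂ) ≠ 0 := by exact_mod_cast (hJpos s hs).ne'
    field_simp
  have l2 : ∫⁻ u, ‖G u‖ₑ ^ 2 ≤ ENNReal.ofReal (1 / c) * ∫⁻ s in S, ‖F s‖ₑ ^ 2 := by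
    have : ∫⁻ u, ‖G u‖ₑ ^ 2 = ∫⁻ u in φ '' S, ‖g u‖ₑ ^ 2 := by
      rw [← lintegral_indicator himg]
      congr with u
      by_cases hu : u ∈ φ '' S <;> simp [hGdef, hu]
    rw [this, lintegral_image_eq_lintegral_abs_det_fderiv_mul volume hS hd hinj,
      ← lintegral_const_mul' _ _ ENNReal.ofReal_ne_top]
    refine setLIntegral_mono' hS (fun s hs => ?_)
    have hj := hJpos s hs
    rw [hJ, hgφ s hs, div_eq_inv_mul, enorm_mul,
      enorm_inv (by exact_mod_cast hj.ne'), mul_pow, ← mul_assoc]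
    gcongr
    have : ‖(J s : ℂ)‖ₑ = ENNReal.ofReal (J s) := by
      rw [← ofReal_norm]; simp [abs_of_pos hj]
    rw [this, ← ENNReal.ofReal_inv_of_pos hj, ← ENNReal.ofReal_pow (by positivity), ← ENNReal.ofReal_mul hj.le]
    apply ENNReal.ofReal_le_ofReal
    have : J s * (J s)⁻¹ ^ 2 = 1 / J s := by field_simp
    rw [this]
    exact one_div_le_one_div_of_le hc (hJc s hs)
  have memG : MemLp G 2 := by
    refine ⟨intG.1, ?_⟩
    have := eLpNorm_nnreal_pow_eq_lintegral (f := G) (μ := volume) (p := 2) (by norm_num)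
    by_contra hcon
    simp only [not_lt, top_le_iff] at hcon
    simp [hcon] at this
    have h3 : ∫⁻ u, ‖G u‖ₑ ^ 2 = ⊤ := by simpa using this.symm
    rw [h3, top_le_iff] at l2
    exact ENNReal.mul_ne_top ENNReal.ofReal_ne_top hfin l2
  refine le_trans (le_of_eq ?_) l2
  rw [← plancherel_ext G intG memG]
  congr with X
  congr 2
  have : ∀ u, G u * Complex.exp (2 * (Real.pi : ℂ) * Complex.I * ((inner ℝ u X : ℝ) : ℂ)) =
    (φ '' S).indicator (fun u => g u * Complex.exp (2 * (Real.pi : ℂ) * Complex.I * ((inner ℝ u X : ℝ) : ℂ))) u := by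
    intro u
    by_cases hu : u ∈ φ '' S <;> simp [hGdef, hu]
  simp_rw [this]
  rw [integral_indicator himg, integral_image_eq_integral_abs_det_fderiv_smul volume hS hd hinj]
  refine setIntegral_congr_fun hS (fun s hs => ?_)
  simp only [hJ, hgφ s hs, Complex.real_smul]
  have : (J s : ℂ) ≠ 0 := by exact_mod_cast (hJpos s hs).ne'
  field_simp


def phiY (y : ℝ) (s : EuclideanSpace ℝ (Fin 5)) : EuclideanSpace ℝ (Fin 5) :=
  !₂[s 0 + s 1, y + s 2, s 3 + s 4, s 0 * y + s 1 * s 2 + s 3 ^ 2 + s 4 ^ 2, s 0 ^ 2 + s 1 ^ 2]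

def phiMat (y : ℝ) (s : EuclideanSpace ℝ (Fin 5)) : Matrix (Fin 5) (Fin 5) ℝ :=
  !![1, 1, 0, 0, 0; 0, 0, 1, 0, 0; 0, 0, 0, 1, 1; y, s 2, s 1, 2 * s 3, 2 * s 4;
    2 * s 0, 2 * s 1, 0, 0, 0]

def phiD (y : ℝ) (s : EuclideanSpace ℝ (Fin 5)) :
    EuclideanSpace ℝ (Fin 5) →L[ℝ] EuclideanSpace ℝ (Fin 5) :=
  LinearMap.toContinuousLinearMap (Matrix.toEuclideanLin (phiMat y s))

theorem phiD_det (y : ℝ) (s : EuclideanSpace ℝ (Fin 5)) :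
    |(phiD y s).det| = 4 * |s 1 - s 0| * |s 4 - s 3| := by
  have h : (phiD y s).det = (phiMat y s).det := by
    rw [phiD, ContinuousLinearMap.det, LinearMap.coe_toContinuousLinearMap,
      Matrix.toEuclideanLin_eq_toLin_orthonormal, LinearMap.det_toLin]
  have h2 : (phiMat y s).det = 4 * (s 1 - s 0) * (s 4 - s 3) ∨
      (phiMat y s).det = -(4 * (s 1 - s 0) * (s 4 - s 3)) := by
    simp [phiMat, Matrix.det_succ_row_zero, Fin.sum_univ_succ, Fin.succAbove]
    first | (left; ring; done) | (right; ring)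
  rw [h]
  rcases h2 with h2 | h2 <;> rw [h2] <;> simp [abs_mul]

theorem phiD_hasFDerivAt (y : ℝ) (s : EuclideanSpace ℝ (Fin 5)) :
    HasFDerivAt (phiY y) (phiD y s) s := by
  have hp : ∀ i : Fin 5, HasFDerivAt (fun s : EuclideanSpace ℝ (Fin 5) => s i)
      (EuclideanSpace.proj i : EuclideanSpace ℝ (Fin 5) →L[ℝ] ℝ) s :=
    fun i => (EuclideanSpace.proj i : EuclideanSpace ℝ (Fin 5) →L[ℝ] ℝ).hasFDerivAt
  rw [← hasFDerivWithinAt_univ, hasFDerivWithinAt_euclidean]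
  intro i
  rw [hasFDerivWithinAt_univ]
  fin_cases i
  · refine ((hp 0).add (hp 1)).congr_fderiv ?_
    ext v; simp [phiD, phiMat, Matrix.mulVec, dotProduct, Fin.sum_univ_succ]
  · refine ((hp 2).const_add y).congr_fderiv ?_
    ext v; simp [phiD, phiMat, Matrix.mulVec, dotProduct, Fin.sum_univ_succ]
  · refine ((hp 3).add (hp 4)).congr_fderiv ?_
    ext v; simp [phiD, phiMat, Matrix.mulVec, dotProduct, Fin.sum_univ_succ]
  · refine (((((hp 0).mul_const y).add ((hp 1).mul (hp 2))).add ((hp 3).pow 2)).add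
      ((hp 4).pow 2)).congr_fderiv ?_
    ext v; simp [phiD, phiMat, Matrix.mulVec, dotProduct, Fin.sum_univ_succ]
    ring
  · refine (((hp 0).pow 2).add ((hp 1).pow 2)).congr_fderiv ?_
    ext v; simp [phiD, phiMat, Matrix.mulVec, dotProduct, Fin.sum_univ_succ]

theorem pair_inj {a b c d : ℝ} (h1 : a + b = c + d) (h2 : a ^ 2 + b ^ 2 = c ^ 2 + d ^ 2)
    (h3 : 0 < (b - a) * (d - c)) : a = c ∧ b = d := by
  have h4 : (b - a) ^ 2 = (d - c) ^ 2 := by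
    have : (a + b) ^ 2 = (c + d) ^ 2 := by rw [h1]
    linarith
  rcases sq_eq_sq_iff_eq_or_eq_neg.1 h4 with h | h
  · constructor <;> linarith
  · rw [h] at h3; nlinarith [sq_nonneg (d - c)]

theorem sep_aux {a b l x x' : ℝ} (h : 5 * l ≤ |a - b|) (hx : x ∈ Set.Icc a (a + l))
    (hx' : x' ∈ Set.Icc b (b + l)) : 4 * l ≤ |x' - x| := by
  obtain ⟨h1, h2⟩ := hx
  obtain ⟨h3, h4⟩ := hx'
  rcases le_abs.1 h with h | h
  · exact le_abs.2 (Or.inr (by linarith))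
  · exact le_abs.2 (Or.inl (by linarith))

theorem sep_aux2 {a b l x x' y y' : ℝ} (hl : 0 < l) (h : 5 * l ≤ |a - b|)
    (hx : x ∈ Set.Icc a (a + l)) (hx' : x' ∈ Set.Icc b (b + l))
    (hy : y ∈ Set.Icc a (a + l)) (hy' : y' ∈ Set.Icc b (b + l)) : 0 < (x' - x) * (y' - y) := by
  obtain ⟨h1, h2⟩ := hx
  obtain ⟨h3, h4⟩ := hx'
  obtain ⟨h5, h6⟩ := hy
  obtain ⟨h7, h8⟩ := hy'
  rcases le_abs.1 h with h | h
  · exact mul_pos_of_neg_of_neg (by linarith) (by linarith)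
  · exact mul_pos (by linarith) (by linarith)

def sBox (a₁ a₂ l₁ b₁ b₂ l₂ : ℝ) : Set (EuclideanSpace ℝ (Fin 5)) :=
  {s | s 0 ∈ Set.Icc a₁ (a₁ + l₁) ∧ s 1 ∈ Set.Icc a₂ (a₂ + l₁) ∧ s 2 ∈ Set.Icc (0:ℝ) 1 ∧
    s 3 ∈ Set.Icc b₁ (b₁ + l₂) ∧ s 4 ∈ Set.Icc b₂ (b₂ + l₂)}

theorem sBox_meas (a₁ a₂ l₁ b₁ b₂ l₂ : ℝ) : MeasurableSet (sBox a₁ a₂ l₁ b₁ b₂ l₂) := by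
  have hm : ∀ i : Fin 5, Measurable fun s : EuclideanSpace ℝ (Fin 5) => s i := fun i => by fun_prop
  exact (hm 0 measurableSet_Icc).inter ((hm 1 measurableSet_Icc).inter ((hm 2 measurableSet_Icc).inter
    ((hm 3 measurableSet_Icc).inter (hm 4 measurableSet_Icc))))

theorem sBox_fin (a₁ a₂ l₁ b₁ b₂ l₂ : ℝ) : volume (sBox a₁ a₂ l₁ b₁ b₂ l₂) ≠ ⊤ := by
  have h : sBox a₁ a₂ l₁ b₁ b₂ l₂ ⊆ (@WithLp.ofLp 2 (Fin 5 → ℝ)) ⁻¹'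
      (Set.Icc ![a₁, a₂, 0, b₁, b₂] ![a₁ + l₁, a₂ + l₁, 1, b₁ + l₂, b₂ + l₂]) := by
    rintro s ⟨h0, h1, h2, h3, h4⟩
    refine ⟨fun i => ?_, fun i => ?_⟩
    · fin_cases i
      exacts [h0.1, h1.1, h2.1, h3.1, h4.1]
    · fin_cases i
      exacts [h0.2, h1.2, h2.2, h3.2, h4.2]
  refine ne_top_of_le_ne_top ?_ (measure_mono h)
  rw [(PiLp.volume_preserving_ofLp (Fin 5)).measure_preimage measurableSet_Icc.nullMeasurableSet]
  exact isCompact_Icc.measure_ne_top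

theorem phiY_inj (y a₁ a₂ l₁ b₁ b₂ l₂ : ℝ) (h1 : 0 < l₁) (h2 : 0 < l₂) (ha : 5 * l₁ ≤ |a₁ - a₂|)
    (hb : 5 * l₂ ≤ |b₁ - b₂|) : Set.InjOn (phiY y) (sBox a₁ a₂ l₁ b₁ b₂ l₂) := by
  rintro s ⟨s0, s1, s2, s3, s4⟩ t ⟨t0, t1, t2, t3, t4⟩ h
  have e : ∀ i, phiY y s i = phiY y t i := fun i => by rw [h]
  have e0 := e 0
  have e1 := e 1
  have e2 := e 2
  have e3 := e 3
  have e4 := e 4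
  simp [phiY] at e0 e1 e2 e3 e4
  obtain ⟨q0, q1⟩ := pair_inj e0 e4 (sep_aux2 h1 ha s0 s1 t0 t1)
  rw [q0, q1, e1] at e3
  obtain ⟨q3, q4⟩ := pair_inj e2 (by linarith) (sep_aux2 h2 hb s3 s4 t3 t4)
  ext i
  fin_cases i
  exacts [q0, q1, e1, q3, q4]

def idxE : Fin 6 ≃ Fin 3 ⊕ Fin 3 where
  toFun := ![Sum.inl 1, Sum.inl 0, Sum.inr 0, Sum.inr 1, Sum.inl 2, Sum.inr 2]
  invFun := Sum.elim ![1, 0, 4] ![2, 3, 5]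
  left_inv := by decide
  right_inv := by decide

def uMap (q : ℝ × EuclideanSpace ℝ (Fin 5)) : (Fin 3 → ℝ) × (Fin 3 → ℝ) :=
  (![q.2 0, q.1, q.2 3], ![q.2 1, q.2 2, q.2 4])

theorem uMap_mp : MeasurePreserving uMap volume volume := by
  have m1 : MeasurePreserving (Prod.map id (@WithLp.ofLp 2 (Fin 5 → ℝ)) : ℝ × EuclideanSpace ℝ (Fin 5) → _)
      volume volume :=
    (MeasurePreserving.id (volume : Measure ℝ)).prod (PiLp.volume_preserving_ofLp (Fin 5))
  have m2 := (volume_preserving_piFinSuccAbove (fun _ : Fin 6 => ℝ) 0).symm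
  have m3 := volume_measurePreserving_piCongrLeft (fun _ : Fin 3 ⊕ Fin 3 => ℝ) idxE
  have m4 := volume_measurePreserving_sumPiEquivProdPi (fun _ : Fin 3 ⊕ Fin 3 => ℝ)
  have m := m4.comp (m3.comp (m2.comp m1))
  convert! m using 1
  funext q
  have key : ∀ (v : Fin 6 → ℝ) (j : Fin 3 ⊕ Fin 3),
      (MeasurableEquiv.piCongrLeft (fun _ : Fin 3 ⊕ Fin 3 => ℝ) idxE) v j = v (idxE.symm j) := by
    intro v j
    obtain ⟨i, rfl⟩ := idxE.surjective j
    simp [MeasurableEquiv.coe_piCongrLeft, Equiv.piCongrLeft_apply_apply]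
  refine Prod.ext ?_ ?_
  · funext i
    have := key ((MeasurableEquiv.piFinSuccAbove (fun _ : Fin 6 => ℝ) 0).symm (q.1, q.2.ofLp)) (Sum.inl i)
    refine Eq.trans ?_ this.symm
    fin_cases i <;> rfl
  · funext i
    have := key ((MeasurableEquiv.piFinSuccAbove (fun _ : Fin 6 => ℝ) 0).symm (q.1, q.2.ofLp)) (Sum.inr i)
    refine Eq.trans ?_ this.symm
    fin_cases i <;> rfl

def phs (ξ : Fin 3 → ℝ) (x : EuclideanSpace ℝ (Fin 5)) : ℂ :=
  Complex.exp (2 * (Real.pi : ℂ) * Complex.I *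
    ((ξ 0 * x 0 + ξ 1 * x 1 + ξ 2 * x 2 + (ξ 0 * ξ 1 + ξ 2 ^ 2) * x 3 + ξ 0 ^ 2 * x 4 : ℝ) : ℂ))

theorem phs_norm (ξ : Fin 3 → ℝ) (x : EuclideanSpace ℝ (Fin 5)) : ‖phs ξ x‖ = 1 := by
  have h : ∀ r : ℝ, ‖Complex.exp (2 * (Real.pi : ℂ) * Complex.I * (r : ℂ))‖ = 1 := by
    intro r
    have : 2 * (Real.pi : ℂ) * Complex.I * (r : ℂ) = ((2 * Real.pi * r : ℝ) : ℂ) * Complex.I := by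
      push_cast; ring
    rw [this, Complex.norm_exp_ofReal_mul_I]
  exact h _

theorem phs_cont (x : EuclideanSpace ℝ (Fin 5)) : Continuous (fun ξ => phs ξ x) := by
  unfold phs
  fun_prop

theorem box_meas (a l₁ b l₂ : ℝ) : MeasurableSet (box a l₁ b l₂) := by
  have hm : ∀ i : Fin 3, Measurable fun s : (Fin 3 → ℝ) => s i := fun i => by fun_prop
  exact (hm 0 measurableSet_Icc).inter ((hm 1 measurableSet_Icc).inter (hm 2 measurableSet_Icc))

theorem box_vol (a l₁ b l₂ : ℝ) : volume (box a l₁ b l₂) = ENNReal.ofReal l₁ * ENNReal.ofReal l₂ := by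
  have h : box a l₁ b l₂ = Set.Icc ![a, 0, b] ![a + l₁, 1, b + l₂] := by
    ext s
    simp [box, Set.mem_Icc, Pi.le_def, Fin.forall_fin_succ]
    tauto
  rw [h, Real.volume_Icc_pi]
  simp [Fin.prod_univ_succ]

theorem eD_eq (a l₁ b l₂ : ℝ) (hb : box a l₁ b l₂ ⊆ cube3) (f : (Fin 3 → ℝ) → ℂ)
    (x : EuclideanSpace ℝ (Fin 5)) :
    eD ((box a l₁ b l₂).indicator f) x = ∫ ξ, (box a l₁ b l₂).indicator f ξ * phs ξ x := by
  unfold eD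
  apply setIntegral_eq_integral_of_forall_compl_eq_zero
  intro ξ hξ
  rw [Set.indicator_of_notMem (fun h => hξ (hb h)), zero_mul]

theorem phs_mul (y : ℝ) (s x : EuclideanSpace ℝ (Fin 5)) :
    phs (uMap (y, s)).1 x * phs (uMap (y, s)).2 x =
      Complex.exp (2 * (Real.pi : ℂ) * Complex.I * ((inner ℝ (phiY y s) x : ℝ) : ℂ)) := by
  rw [phs, phs, ← Complex.exp_add, ← mul_add, ← Complex.ofReal_add]
  congr 3
  simp [uMap, phiY, PiLp.inner_apply, Fin.sum_univ_succ]
  ring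

theorem uMap_mem (a₁ a₂ l₁ b₁ b₂ l₂ y : ℝ) (s : EuclideanSpace ℝ (Fin 5)) :
    ((uMap (y, s)).1 ∈ box a₁ l₁ b₁ l₂ ∧ (uMap (y, s)).2 ∈ box a₂ l₁ b₂ l₂) ↔
      (y ∈ Set.Icc (0:ℝ) 1 ∧ s ∈ sBox a₁ a₂ l₁ b₁ b₂ l₂) := by
  simp only [uMap, box, sBox, Set.mem_ofPred_eq, Matrix.cons_val_zero, Matrix.cons_val_one,
    Matrix.cons_val]
  tauto

theorem int_aux (x : EuclideanSpace ℝ (Fin 5)) (B : Set (Fin 3 → ℝ)) (f : (Fin 3 → ℝ) → ℂ)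
    (hB : MeasurableSet B) (hf : IntegrableOn f B) :
    Integrable (fun ξ => B.indicator f ξ * phs ξ x) := by
  have := (hf.integrable_indicator hB)
  refine this.mul_bdd (c := 1) (phs_cont x).aestronglyMeasurable ?_
  exact Filter.Eventually.of_forall fun ξ => (phs_norm ξ x).le

theorem cs_aux (h : ℝ → ℂ) (mx : StronglyMeasurable h) :
    ‖∫ y in Set.Icc (0:ℝ) 1, h y‖ₑ ^ 2 ≤ ∫⁻ y in Set.Icc (0:ℝ) 1, ‖h y‖ₑ ^ 2 := by
  have hprob : IsProbabilityMeasure (volume.restrict (Set.Icc (0:ℝ) 1)) := ⟨by simp⟩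
  have le := eLpNorm_le_eLpNorm_of_exponent_le (p := 1) (q := 2) (by norm_num)
    (mx.aestronglyMeasurable (μ := volume.restrict (Set.Icc (0:ℝ) 1)))
  have := eLpNorm_nnreal_pow_eq_lintegral (f := h) (μ := volume.restrict (Set.Icc (0:ℝ) 1)) (p := 2) (by norm_num)
  calc _ ≤ (eLpNorm h 1 (volume.restrict (Set.Icc (0:ℝ) 1))) ^ 2 := by
        gcongr
        rw [eLpNorm_one_eq_lintegral_enorm]
        exact enorm_integral_le_lintegral_enorm _
    _ ≤ (eLpNorm h 2 (volume.restrict (Set.Icc (0:ℝ) 1))) ^ 2 := by gcongr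
    _ = _ := by simpa using this

set_option maxHeartbeats 2000000 in
theorem L2_bound (a₁ a₂ l₁ b₁ b₂ l₂ : ℝ) (h1 : 0 < l₁) (h2 : 0 < l₂)
    (hb1 : box a₁ l₁ b₁ l₂ ⊆ cube3) (hb2 : box a₂ l₁ b₂ l₂ ⊆ cube3)
    (ha : 5 * l₁ ≤ |a₁ - a₂|) (hb : 5 * l₂ ≤ |b₁ - b₂|)
    (f₁ f₂ : (Fin 3 → ℝ) → ℂ) (m1 : Measurable f₁) (m2 : Measurable f₂)
    (i1 : IntegrableOn f₁ (box a₁ l₁ b₁ l₂)) (i2 : IntegrableOn f₂ (box a₂ l₁ b₂ l₂)) :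
    ∫⁻ x, ‖eD ((box a₁ l₁ b₁ l₂).indicator f₁) x * eD ((box a₂ l₁ b₂ l₂).indicator f₂) x‖ₑ ^ 2 ≤
      ENNReal.ofReal (1 / (64 * (l₁ * l₂))) * ((∫⁻ ξ in box a₁ l₁ b₁ l₂, ‖f₁ ξ‖ₑ ^ 2) *
        ∫⁻ ξ in box a₂ l₁ b₂ l₂, ‖f₂ ξ‖ₑ ^ 2) := by
  have mB1 := box_meas a₁ l₁ b₁ l₂
  have mB2 := box_meas a₂ l₁ b₂ l₂
  set B₁ := box a₁ l₁ b₁ l₂ with hB1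
  set B₂ := box a₂ l₁ b₂ l₂ with hB2
  have mS := sBox_meas a₁ a₂ l₁ b₁ b₂ l₂
  set S := sBox a₁ a₂ l₁ b₁ b₂ l₂ with hS
  have mU : Measurable uMap := uMap_mp.measurable
  set F : ℝ → EuclideanSpace ℝ (Fin 5) → ℂ := fun y s => f₁ (uMap (y, s)).1 * f₂ (uMap (y, s)).2 with hFdef
  have mF : Measurable (Function.uncurry F) :=
    (m1.comp (measurable_fst.comp mU)).mul (m2.comp (measurable_snd.comp mU))
  set H : ℝ → EuclideanSpace ℝ (Fin 5) → ℂ := fun y x => ∫ s in S, F y s *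
    Complex.exp (2 * (Real.pi : ℂ) * Complex.I * ((inner ℝ (phiY y s) x : ℝ) : ℂ)) with hHdef
  have cphi : Continuous (fun q : ℝ × EuclideanSpace ℝ (Fin 5) => phiY q.1 q.2) := by
    unfold phiY
    refine (PiLp.continuous_toLp 2 _).comp (continuous_pi fun i => ?_)
    fin_cases i <;> simp <;> fun_prop
  have mH : StronglyMeasurable (Function.uncurry H) := by
    have : StronglyMeasurable (fun q : (ℝ × EuclideanSpace ℝ (Fin 5)) × EuclideanSpace ℝ (Fin 5) =>
      F q.1.1 q.2 * Complex.exp (2 * (Real.pi : ℂ) * Complex.I * ((inner ℝ (phiY q.1.1 q.2) q.1.2 : ℝ) : ℂ))) := by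
      apply Measurable.stronglyMeasurable
      refine Measurable.mul (mF.comp (g := Function.uncurry F) (f := fun q : (ℝ × EuclideanSpace ℝ (Fin 5)) × EuclideanSpace ℝ (Fin 5) => (q.1.1, q.2)) (by fun_prop)) ?_
      apply Continuous.measurable
      have : Continuous (fun q : (ℝ × EuclideanSpace ℝ (Fin 5)) × EuclideanSpace ℝ (Fin 5) => phiY q.1.1 q.2) :=
        cphi.comp (by fun_prop : Continuous fun q : (ℝ × EuclideanSpace ℝ (Fin 5)) × EuclideanSpace ℝ (Fin 5) => (q.1.1, q.2))
      fun_prop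
    exact this.integral_prod_right (ν := volume.restrict S)
  -- product formula
  have prodf : ∀ x, eD (B₁.indicator f₁) x * eD (B₂.indicator f₂) x =
      ∫ y in Set.Icc (0:ℝ) 1, H y x := by
    intro x
    rw [eD_eq _ _ _ _ hb1, eD_eq _ _ _ _ hb2, ← integral_prod_mul]
    have int2 := (int_aux x B₁ f₁ mB1 i1).mul_prod (int_aux x B₂ f₂ mB2 i2)
    rw [← Measure.volume_eq_prod] at int2
    have int3 := uMap_mp.integrable_comp_of_integrable int2
    have e1 := integral_map uMap_mp.measurable.aemeasurable (μ := volume)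
      (f := fun z : (Fin 3 → ℝ) × (Fin 3 → ℝ) => B₁.indicator f₁ z.1 * phs z.1 x * (B₂.indicator f₂ z.2 * phs z.2 x))
      (by rw [uMap_mp.map_eq]; exact int2.1)
    rw [uMap_mp.map_eq] at e1
    rw [← Measure.volume_eq_prod, e1]
    have e2 := integral_prod (μ := (volume : Measure ℝ))
      (ν := (volume : Measure (EuclideanSpace ℝ (Fin 5)))) _ (by rw [← Measure.volume_eq_prod]; exact int3)
    rw [← Measure.volume_eq_prod] at e2
    simp only [Function.comp_apply] at e2
    rw [e2]
    rw [← integral_indicator measurableSet_Icc]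
    congr 1
    funext y
    have pt : ∀ s, B₁.indicator f₁ (uMap (y, s)).1 * phs (uMap (y, s)).1 x *
        (B₂.indicator f₂ (uMap (y, s)).2 * phs (uMap (y, s)).2 x) =
        (Set.Icc (0:ℝ) 1).indicator (fun y => S.indicator (fun s => F y s *
          Complex.exp (2 * (Real.pi : ℂ) * Complex.I * ((inner ℝ (phiY y s) x : ℝ) : ℂ))) s) y := by
      intro s
      have hm := uMap_mem a₁ a₂ l₁ b₁ b₂ l₂ y s
      by_cases hc : y ∈ Set.Icc (0:ℝ) 1 ∧ s ∈ S
      · obtain ⟨q1, q2⟩ := hm.2 hc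
        rw [Set.indicator_of_mem q1, Set.indicator_of_mem q2, Set.indicator_of_mem hc.1,
          Set.indicator_of_mem hc.2, ← phs_mul]
        simp only [hFdef]; ring
      · have hn := fun h => hc (hm.1 h)
        have r : (Set.Icc (0:ℝ) 1).indicator (fun y => S.indicator (fun s => F y s *
          Complex.exp (2 * (Real.pi : ℂ) * Complex.I * ((inner ℝ (phiY y s) x : ℝ) : ℂ))) s) y = 0 := by
          by_cases hy : y ∈ Set.Icc (0:ℝ) 1
          · rw [Set.indicator_of_mem hy, Set.indicator_of_notMem (fun h => hc ⟨hy, h⟩)]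
          · rw [Set.indicator_of_notMem hy]
        rw [r]
        by_cases q1 : (uMap (y, s)).1 ∈ B₁
        · rw [Set.indicator_of_notMem (s := B₂) (fun h => hn ⟨q1, h⟩)]; simp
        · rw [Set.indicator_of_notMem (s := B₁) q1]; simp
    refine (integral_congr_ae (Filter.Eventually.of_forall pt)).trans ?_
    by_cases hy : y ∈ Set.Icc (0:ℝ) 1
    · simp only [Set.indicator_of_mem hy]
      rw [integral_indicator mS]
    · simp only [Set.indicator_of_notMem hy]; simp
  have hH : ∀ y x, H y x = ∫ s in S, F y s *
    Complex.exp (2 * (Real.pi : ℂ) * Complex.I * ((inner ℝ (phiY y s) x : ℝ) : ℂ)) := fun y x => rfl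
  clear_value H
  -- Cauchy-Schwarz
  have cs : ∀ x, ‖∫ y in Set.Icc (0:ℝ) 1, H y x‖ₑ ^ 2 ≤ ∫⁻ y in Set.Icc (0:ℝ) 1, ‖H y x‖ₑ ^ 2 := by
    intro x
    have mx : StronglyMeasurable (fun y => H y x) :=
      mH.comp_measurable (by fun_prop : Measurable fun y : ℝ => (y, x))
    exact cs_aux _ mx
  calc _ ≤ ∫⁻ x, ∫⁻ y in Set.Icc (0:ℝ) 1, ‖H y x‖ₑ ^ 2 := by
        simp only [prodf]
        apply lintegral_mono
        intro x
        exact cs x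
    _ = ∫⁻ y in Set.Icc (0:ℝ) 1, ∫⁻ x, ‖H y x‖ₑ ^ 2 := by
        rw [lintegral_lintegral_swap]
        have : Measurable (fun q : EuclideanSpace ℝ (Fin 5) × ℝ => ‖Function.uncurry H (q.2, q.1)‖ₑ ^ 2) :=
          (mH.measurable.comp (by fun_prop : Measurable fun q : EuclideanSpace ℝ (Fin 5) × ℝ => (q.2, q.1))).enorm.pow_const 2
        exact this.aemeasurable
    _ ≤ ∫⁻ y in Set.Icc (0:ℝ) 1, ENNReal.ofReal (1 / (64 * (l₁ * l₂))) * ∫⁻ s in S, ‖F y s‖ₑ ^ 2 := by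
        apply lintegral_mono
        intro y
        simp only [hH]
        refine change_var_ext S mS (sBox_fin _ _ _ _ _ _) (phiY y) (phiD y) (phiD_hasFDerivAt y)
          (phiY_inj y _ _ _ _ _ _ h1 h2 ha hb) (fun s => 4 * |s 1 - s 0| * |s 4 - s 3|)
          (by fun_prop) (phiD_det y) (64 * (l₁ * l₂)) (by positivity) ?_ (F y)
          (mF.comp (by fun_prop : Measurable fun s : EuclideanSpace ℝ (Fin 5) => (y, s)))
        rintro s ⟨s0, s1, s2, s3, s4⟩
        have q1 := sep_aux ha s0 s1
        have q2 := sep_aux hb s3 s4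
        have := mul_le_mul q1 q2 (by positivity) (by positivity)
        simp only
        nlinarith
    _ = ENNReal.ofReal (1 / (64 * (l₁ * l₂))) * ∫⁻ y in Set.Icc (0:ℝ) 1, ∫⁻ s in S, ‖F y s‖ₑ ^ 2 := by
        rw [lintegral_const_mul' _ _ ENNReal.ofReal_ne_top]
    _ = _ := by
        congr 1
        have mg1 : Measurable (B₁.indicator fun ξ => ‖f₁ ξ‖ₑ ^ 2) := (m1.enorm.pow_const 2).indicator mB1
        have mg2 : Measurable (B₂.indicator fun ξ => ‖f₂ ξ‖ₑ ^ 2) := (m2.enorm.pow_const 2).indicator mB2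
        rw [← lintegral_indicator mB1, ← lintegral_indicator mB2,
          ← lintegral_prod_mul mg1.aemeasurable mg2.aemeasurable]
        have mm : Measurable (fun z : (Fin 3 → ℝ) × (Fin 3 → ℝ) =>
          B₁.indicator (fun ξ => ‖f₁ ξ‖ₑ ^ 2) z.1 * B₂.indicator (fun ξ => ‖f₂ ξ‖ₑ ^ 2) z.2) :=
          (mg1.comp measurable_fst).mul (mg2.comp measurable_snd)
        have e1 := uMap_mp.lintegral_comp mm
        have e2 := lintegral_prod (μ := (volume : Measure ℝ))
          (ν := (volume : Measure (EuclideanSpace ℝ (Fin 5)))) _ (mm.comp mU).aemeasurable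
        rw [← Measure.volume_eq_prod] at e2 ⊢
        simp only [Function.comp_apply] at e2
        rw [← e1, e2]
        rw [← lintegral_indicator measurableSet_Icc]
        congr 1
        funext y
        by_cases hy : y ∈ Set.Icc (0:ℝ) 1
        · rw [Set.indicator_of_mem hy, ← lintegral_indicator mS]
          congr 1
          funext s
          have hm := uMap_mem a₁ a₂ l₁ b₁ b₂ l₂ y s
          by_cases hc : s ∈ S
          · obtain ⟨q1, q2⟩ := hm.2 ⟨hy, hc⟩
            rw [Set.indicator_of_mem q1, Set.indicator_of_mem q2, Set.indicator_of_mem hc]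
            simp only [hFdef, enorm_mul]; ring
          · have hn := fun h => hc (hm.1 h).2
            rw [Set.indicator_of_notMem hc]
            by_cases q1 : (uMap (y, s)).1 ∈ B₁
            · rw [Set.indicator_of_notMem (s := B₂) (fun h => hn ⟨q1, h⟩)]; simp
            · rw [Set.indicator_of_notMem (s := B₁) q1]; simp
        · rw [Set.indicator_of_notMem hy]
          have z : ∀ s, B₁.indicator (fun ξ => ‖f₁ ξ‖ₑ ^ 2) (uMap (y, s)).1 *
              B₂.indicator (fun ξ => ‖f₂ ξ‖ₑ ^ 2) (uMap (y, s)).2 = 0 := by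
            intro s
            have hm := uMap_mem a₁ a₂ l₁ b₁ b₂ l₂ y s
            have hn := fun h => hy (hm.1 h).1
            by_cases q1 : (uMap (y, s)).1 ∈ B₁
            · rw [Set.indicator_of_notMem (s := B₂) (fun h => hn ⟨q1, h⟩)]; simp
            · rw [Set.indicator_of_notMem (s := B₁) q1]; simp
          simp only [z, lintegral_zero]

theorem eD_zero (a l₁ b l₂ : ℝ) (hb : box a l₁ b l₂ ⊆ cube3) (f : (Fin 3 → ℝ) → ℂ)
    (hf : ¬ IntegrableOn f (box a l₁ b l₂)) (x : EuclideanSpace ℝ (Fin 5)) :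
    eD ((box a l₁ b l₂).indicator f) x = 0 := by
  rw [eD_eq _ _ _ _ hb]
  apply integral_undef
  intro h
  apply hf
  rw [← integrable_indicator_iff (box_meas _ _ _ _)]
  have h2 := h.mul_bdd (c := 1) (g := fun ξ => (phs ξ x)⁻¹)
    ((phs_cont x).measurable.inv.aestronglyMeasurable)
    (Filter.Eventually.of_forall fun ξ => by rw [norm_inv, phs_norm, inv_one])
  refine h2.congr (Filter.Eventually.of_forall fun ξ => ?_)
  have : phs ξ x ≠ 0 := by
    intro h0
    have := phs_norm ξ x
    rw [h0] at this
    simp at this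
  simp only
  field_simp

theorem eD_le (a l₁ b l₂ : ℝ) (hb : box a l₁ b l₂ ⊆ cube3) (f : (Fin 3 → ℝ) → ℂ)
    (x : EuclideanSpace ℝ (Fin 5)) :
    ‖eD ((box a l₁ b l₂).indicator f) x‖ₑ ≤ eLpNorm f 1 (volume.restrict (box a l₁ b l₂)) := by
  rw [eD_eq _ _ _ _ hb, eLpNorm_one_eq_lintegral_enorm, ← lintegral_indicator (box_meas _ _ _ _)]
  refine (enorm_integral_le_lintegral_enorm _).trans (lintegral_mono fun ξ => ?_)
  rw [enorm_mul]
  have : ‖phs ξ x‖ₑ = 1 := by rw [← ofReal_norm, phs_norm]; simp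
  rw [this, mul_one]
  by_cases h : ξ ∈ box a l₁ b l₂ <;> simp [h]

theorem eD_congr (a l₁ b l₂ : ℝ) (hb : box a l₁ b l₂ ⊆ cube3) (f g : (Fin 3 → ℝ) → ℂ)
    (hfg : f =ᵐ[volume.restrict (box a l₁ b l₂)] g) (x : EuclideanSpace ℝ (Fin 5)) :
    eD ((box a l₁ b l₂).indicator f) x = eD ((box a l₁ b l₂).indicator g) x := by
  rw [eD_eq _ _ _ _ hb, eD_eq _ _ _ _ hb]
  apply integral_congr_ae
  rw [Filter.EventuallyEq, ae_restrict_iff' (box_meas _ _ _ _)] at hfg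
  filter_upwards [hfg] with ξ h
  by_cases hξ : ξ ∈ box a l₁ b l₂
  · simp [hξ, h hξ]
  · simp [hξ]

theorem eD_meas (a l₁ b l₂ : ℝ) (hb : box a l₁ b l₂ ⊆ cube3) (f : (Fin 3 → ℝ) → ℂ)
    (mf : Measurable f) : Measurable (eD ((box a l₁ b l₂).indicator f)) := by
  have h : eD ((box a l₁ b l₂).indicator f) =
      fun x => ∫ ξ, (box a l₁ b l₂).indicator f ξ * phs ξ x := by
    funext x; exact eD_eq _ _ _ _ hb f x
  rw [h]
  have : StronglyMeasurable (fun q : EuclideanSpace ℝ (Fin 5) × (Fin 3 → ℝ) =>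
      (box a l₁ b l₂).indicator f q.2 * phs q.2 q.1) := by
    apply Measurable.stronglyMeasurable
    refine ((mf.indicator (box_meas _ _ _ _)).comp measurable_snd).mul ?_
    apply Continuous.measurable
    unfold phs
    fun_prop
  exact (this.integral_prod_right (ν := volume)).measurable

theorem algebra_aux (p : ℝ) (hp : 4 ≤ p) (A N₁ N₂ : ENNReal) (hA0 : A ≠ 0) (hAt : A ≠ ⊤) :
    ((N₁ * A ^ (1 - 1 / p)) * (N₂ * A ^ (1 - 1 / p))) ^ (p / 2 - 2) *
      (A⁻¹ * ((N₁ * A ^ (1 / 2 - 1 / p)) ^ 2 * (N₂ * A ^ (1 / 2 - 1 / p)) ^ 2)) =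
    (A ^ (1 - 4 / p) * N₁ ^ ((1:ℝ) / 2) * N₂ ^ ((1:ℝ) / 2)) ^ p := by
  have hp0 : (0:ℝ) < p := by linarith
  have hq : 0 ≤ p / 2 - 2 := by linarith
  have e1 : ∀ N : ENNReal, N ^ (p / 2) = N ^ (p / 2 - 2) * N ^ 2 := by
    intro N
    rw [← ENNReal.rpow_natCast, ← ENNReal.rpow_add_of_nonneg _ _ hq (by norm_num)]
    congr 1; push_cast; ring
  have eA : (A ^ (1 - 4 / p)) ^ p = (A ^ (1 - 1 / p)) ^ (p / 2 - 2) * (A ^ (1 - 1 / p)) ^ (p / 2 - 2) *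
      (A⁻¹ * (A ^ (1 / 2 - 1 / p)) ^ 2 * (A ^ (1 / 2 - 1 / p)) ^ 2) := by
    rw [← ENNReal.rpow_neg_one]
    simp only [← ENNReal.rpow_natCast, ← ENNReal.rpow_mul]
    simp only [← ENNReal.rpow_add _ _ hA0 hAt]
    congr 1
    field_simp
    push_cast
    ring
  rw [ENNReal.mul_rpow_of_nonneg _ _ hp0.le, ENNReal.mul_rpow_of_nonneg _ _ hp0.le, eA,
    ← ENNReal.rpow_mul N₁, ← ENNReal.rpow_mul N₂, show (1:ℝ) / 2 * p = p / 2 by ring, e1, e1,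
    ENNReal.mul_rpow_of_nonneg _ _ hq, ENNReal.mul_rpow_of_nonneg _ _ hq,
    ENNReal.mul_rpow_of_nonneg _ _ hq]
  ring

theorem main_meas (p : ℝ) (hp : 4 ≤ p) (a₁ a₂ l₁ b₁ b₂ l₂ : ℝ) (h1 : 0 < l₁) (h2 : 0 < l₂)
    (hb1 : box a₁ l₁ b₁ l₂ ⊆ cube3) (hb2 : box a₂ l₁ b₂ l₂ ⊆ cube3)
    (ha : 5 * l₁ ≤ |a₁ - a₂|) (hb : 5 * l₂ ≤ |b₁ - b₂|)
    (f₁ f₂ : (Fin 3 → ℝ) → ℂ) (m1 : Measurable f₁) (m2 : Measurable f₂)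
    (i1 : IntegrableOn f₁ (box a₁ l₁ b₁ l₂)) (i2 : IntegrableOn f₂ (box a₂ l₁ b₂ l₂)) :
    eLpNorm (fun x : EuclideanSpace ℝ (Fin 5) =>
            ‖eD (Set.indicator (box a₁ l₁ b₁ l₂) f₁) x‖ ^ ((1:ℝ)/2) *
            ‖eD (Set.indicator (box a₂ l₁ b₂ l₂) f₂) x‖ ^ ((1:ℝ)/2))
          (ENNReal.ofReal p) volume ≤
        ENNReal.ofReal (1 * (l₁ * l₂) ^ (1 - 4/p)) *
          (eLpNorm f₁ (ENNReal.ofReal p) (volume.restrict (box a₁ l₁ b₁ l₂))) ^ ((1:ℝ)/2) *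
          (eLpNorm f₂ (ENNReal.ofReal p) (volume.restrict (box a₂ l₁ b₂ l₂))) ^ ((1:ℝ)/2) := by
  have hp0 : (0:ℝ) < p := by linarith
  have hq : 0 ≤ p / 2 - 2 := by linarith
  have hl : 0 < l₁ * l₂ := by positivity
  have L2 := L2_bound a₁ a₂ l₁ b₁ b₂ l₂ h1 h2 hb1 hb2 ha hb f₁ f₂ m1 m2 i1 i2
  set A := ENNReal.ofReal (l₁ * l₂) with hA
  have hA0 : A ≠ 0 := by simpa [hA] using hl
  have hAt : A ≠ ⊤ := ENNReal.ofReal_ne_top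
  have hvol : ∀ a b, volume (box a l₁ b l₂) = A := by
    intro a b; rw [box_vol, hA, ENNReal.ofReal_mul h1.le]
  have hol : ∀ (a b : ℝ) (f : (Fin 3 → ℝ) → ℂ), Measurable f →
      eLpNorm f 1 (volume.restrict (box a l₁ b l₂)) ≤
        eLpNorm f (ENNReal.ofReal p) (volume.restrict (box a l₁ b l₂)) * A ^ (1 - 1 / p) ∧
      ∫⁻ ξ in box a l₁ b l₂, ‖f ξ‖ₑ ^ 2 ≤
        (eLpNorm f (ENNReal.ofReal p) (volume.restrict (box a l₁ b l₂)) * A ^ (1 / 2 - 1 / p)) ^ 2 := by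
    intro a b f mf
    constructor
    · have := eLpNorm_le_eLpNorm_mul_rpow_measure_univ (p := 1) (q := ENNReal.ofReal p)
        (by rw [← ENNReal.ofReal_one]; exact ENNReal.ofReal_le_ofReal (by linarith))
        (mf.aestronglyMeasurable (μ := volume.restrict (box a l₁ b l₂)))
      rw [Measure.restrict_apply_univ, hvol, ENNReal.toReal_ofReal hp0.le] at this
      simpa using this
    · have := eLpNorm_le_eLpNorm_mul_rpow_measure_univ (p := 2) (q := ENNReal.ofReal p)
        (by rw [← ENNReal.ofReal_ofNat]; exact ENNReal.ofReal_le_ofReal (by linarith))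
        (mf.aestronglyMeasurable (μ := volume.restrict (box a l₁ b l₂)))
      rw [Measure.restrict_apply_univ, hvol, ENNReal.toReal_ofReal hp0.le] at this
      have e := eLpNorm_nnreal_pow_eq_lintegral (f := f) (μ := volume.restrict (box a l₁ b l₂)) (p := 2) (by norm_num)
      have e' : ∫⁻ ξ in box a l₁ b l₂, ‖f ξ‖ₑ ^ 2 = eLpNorm f 2 (volume.restrict (box a l₁ b l₂)) ^ 2 := by
        simpa using e.symm
      rw [e']
      gcongr
      simpa using this
  obtain ⟨s1, t1⟩ := hol a₁ b₁ f₁ m1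
  obtain ⟨s2, t2⟩ := hol a₂ b₂ f₂ m2
  have u1 := fun x => (eD_le a₁ l₁ b₁ l₂ hb1 f₁ x).trans s1
  have u2 := fun x => (eD_le a₂ l₁ b₂ l₂ hb2 f₂ x).trans s2
  have d1 := eD_meas a₁ l₁ b₁ l₂ hb1 f₁ m1
  have d2 := eD_meas a₂ l₁ b₂ l₂ hb2 f₂ m2
  set N₁ := eLpNorm f₁ (ENNReal.ofReal p) (volume.restrict (box a₁ l₁ b₁ l₂))
  set N₂ := eLpNorm f₂ (ENNReal.ofReal p) (volume.restrict (box a₂ l₁ b₂ l₂))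
  generalize eD (Set.indicator (box a₁ l₁ b₁ l₂) f₁) = E₁ at *
  generalize eD (Set.indicator (box a₂ l₁ b₂ l₂) f₂) = E₂ at *
  have hD : ENNReal.ofReal (1 / (64 * (l₁ * l₂))) ≤ A⁻¹ := by
    rw [hA, ← ENNReal.ofReal_inv_of_pos hl]
    apply ENNReal.ofReal_le_ofReal
    rw [one_div]
    apply inv_anti₀ hl
    linarith
  have hR : ENNReal.ofReal (1 * (l₁ * l₂) ^ (1 - 4/p)) = A ^ (1 - 4 / p) := by
    rw [one_mul, hA, ENNReal.ofReal_rpow_of_pos hl]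
  rw [hR, eLpNorm_eq_lintegral_rpow_enorm_toReal (by simpa using hp0) ENNReal.ofReal_ne_top,
    ENNReal.toReal_ofReal hp0.le, one_div p, ENNReal.rpow_inv_le_iff hp0, ← algebra_aux p hp A N₁ N₂ hA0 hAt]
  calc _ ≤ ∫⁻ x, ((N₁ * A ^ (1 - 1 / p)) * (N₂ * A ^ (1 - 1 / p))) ^ (p / 2 - 2) * ‖E₁ x * E₂ x‖ₑ ^ 2 := by
        apply lintegral_mono
        intro x
        have e : ‖‖E₁ x‖ ^ ((1:ℝ) / 2) * ‖E₂ x‖ ^ ((1:ℝ) / 2)‖ₑ ^ p = ‖E₁ x * E₂ x‖ₑ ^ (p / 2) := by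
          have : ∀ z : ℂ, ‖‖z‖ ^ ((1:ℝ) / 2)‖ₑ = ‖z‖ₑ ^ ((1:ℝ) / 2) := by
            intro z
            rw [Real.enorm_eq_ofReal (by positivity), ← ENNReal.ofReal_rpow_of_nonneg (norm_nonneg _) (by norm_num), ofReal_norm]
          rw [enorm_mul, this, this, enorm_mul, ← ENNReal.mul_rpow_of_nonneg _ _ (by norm_num), ← ENNReal.rpow_mul]
          congr 1; ring
        have e1 : ∀ N : ENNReal, N ^ (p / 2) = N ^ (p / 2 - 2) * N ^ 2 := by
          intro N
          rw [← ENNReal.rpow_natCast, ← ENNReal.rpow_add_of_nonneg _ _ hq (by norm_num)]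
          congr 1; push_cast; ring
        beta_reduce
        rw [e, e1]
        gcongr
        rw [enorm_mul]
        exact mul_le_mul' (u1 x) (u2 x)
    _ ≤ ((N₁ * A ^ (1 - 1 / p)) * (N₂ * A ^ (1 - 1 / p))) ^ (p / 2 - 2) * ∫⁻ x, ‖E₁ x * E₂ x‖ₑ ^ 2 := by
        exact (lintegral_const_mul _ ((d1.mul d2).enorm.pow_const 2)).le
    _ ≤ _ := by
        gcongr
        refine L2.trans ?_
        gcongr

theorem bilinear_restriction_separated (p : ℝ) (hp : 4 ≤ p) :
    ∃ C : ℝ, 0 < C ∧ ∀ l₁ l₂ a₁ a₂ b₁ b₂ : ℝ, 0 < l₁ → 0 < l₂ →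
      box a₁ l₁ b₁ l₂ ⊆ cube3 → box a₂ l₁ b₂ l₂ ⊆ cube3 →
      5 * l₁ ≤ |a₁ - a₂| → 5 * l₂ ≤ |b₁ - b₂| →
      ∀ f₁ f₂ : (Fin 3 → ℝ) → ℂ,
        eLpNorm (fun x : EuclideanSpace ℝ (Fin 5) =>
            ‖eD (Set.indicator (box a₁ l₁ b₁ l₂) f₁) x‖ ^ ((1:ℝ)/2) *
            ‖eD (Set.indicator (box a₂ l₁ b₂ l₂) f₂) x‖ ^ ((1:ℝ)/2))
          (ENNReal.ofReal p) volume ≤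
        ENNReal.ofReal (C * (l₁ * l₂) ^ (1 - 4/p)) *
          (eLpNorm f₁ (ENNReal.ofReal p) (volume.restrict (box a₁ l₁ b₁ l₂))) ^ ((1:ℝ)/2) *
          (eLpNorm f₂ (ENNReal.ofReal p) (volume.restrict (box a₂ l₁ b₂ l₂))) ^ ((1:ℝ)/2) := by
  refine ⟨1, one_pos, ?_⟩
  intro l₁ l₂ a₁ a₂ b₁ b₂ h1 h2 hb1 hb2 ha hb f₁ f₂
  have hz : (0:ℝ) ^ ((1:ℝ)/2) = 0 := Real.zero_rpow (by norm_num)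
  by_cases i1 : IntegrableOn f₁ (box a₁ l₁ b₁ l₂)
  swap
  · simp only [eD_zero a₁ l₁ b₁ l₂ hb1 f₁ i1, norm_zero, hz, zero_mul, eLpNorm_zero']
    exact zero_le
  by_cases i2 : IntegrableOn f₂ (box a₂ l₁ b₂ l₂)
  swap
  · simp only [eD_zero a₂ l₁ b₂ l₂ hb2 f₂ i2, norm_zero, hz, mul_zero, eLpNorm_zero']
    exact zero_le
  have e1 := i1.1.ae_eq_mk
  have e2 := i2.1.ae_eq_mk
  have k := main_meas p hp a₁ a₂ l₁ b₁ b₂ l₂ h1 h2 hb1 hb2 ha hb _ _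
    i1.1.stronglyMeasurable_mk.measurable i2.1.stronglyMeasurable_mk.measurable
    (i1.congr e1) (i2.congr e2)
  rw [← eLpNorm_congr_ae e1, ← eLpNorm_congr_ae e2] at k
  simp only [← eD_congr a₁ l₁ b₁ l₂ hb1 _ _ e1, ← eD_congr a₂ l₁ b₂ l₂ hb2 _ _ e2] at k
  exact k
end
end
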